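/- Let ρ > 0 and let μ be a probability measure on ℝ^d with density exp(−H) with respect to Lebesgue measure, where H : ℝ^d → ℝ is a smooth function whose Hessian satisfies ⟨Hess H(x) y, y⟩ ≥ ρ·‖y‖² for all x, y ∈ ℝ^d. Let I ⊆ ℝ be a closed interval and Φ : I → ℝ a C² convex function satisfying (H1). Then for every smooth function f : ℝ^d → I that is bounded with bounded gradient, Ent_μ^Φ(f) ≤ (1/(2ρ)) · ∫ Φ''(f(x)) · ‖∇f(x)‖² dμ(x). -/

import Mathlib

open MeasureTheory

namespace PhiSobolev

open scoped ContDiff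

variable {E : Type*} [NormedAddCommGroup E] [InnerProductSpace ℝ E]

/-- Smooth functions whose first two derivatives are bounded by `M` and whose second derivative
is `M`-Lipschitz. -/
structure Reg (u : E → ℝ) (M : ℝ) : Prop where
  contDiff : ContDiff ℝ ∞ u
  d1 : ∀ x, ‖fderiv ℝ u x‖ ≤ M
  d2 : ∀ x, ‖fderiv ℝ (fderiv ℝ u) x‖ ≤ M
  d3 : ∀ x y, ‖fderiv ℝ (fderiv ℝ u) x - fderiv ℝ (fderiv ℝ u) y‖ ≤ M * ‖x - y‖

/-- Strongly monotone smooth vector fields with bounded derivatives. -/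
structure Drift (b : E → E) (ρ L : ℝ) : Prop where
  contDiff : ContDiff ℝ ∞ b
  d1 : ∀ x, ‖fderiv ℝ b x‖ ≤ L
  d2 : ∀ x, ‖fderiv ℝ (fderiv ℝ b) x‖ ≤ L
  d3 : ∀ x y, ‖fderiv ℝ (fderiv ℝ b) x - fderiv ℝ (fderiv ℝ b) y‖ ≤ L * ‖x - y‖
  mono : ∀ x y, ρ * ‖y‖ ^ 2 ≤ inner ℝ (fderiv ℝ b x y) y

theorem fderiv_contDiff {F : Type*} [NormedAddCommGroup F] [NormedSpace ℝ F] {u : E → F}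
    (hu : ContDiff ℝ ∞ u) : ContDiff ℝ ∞ (fderiv ℝ u) :=
  hu.fderiv_right (by simp)

theorem lipschitz_of_fderiv {F : Type*} [NormedAddCommGroup F] [NormedSpace ℝ F] {u : E → F}
    (hu : ContDiff ℝ ∞ u) {M : ℝ} (h : ∀ x, ‖fderiv ℝ u x‖ ≤ M) (x y : E) :
    ‖u x - u y‖ ≤ M * ‖x - y‖ :=
  Convex.norm_image_sub_le_of_norm_fderiv_le (s := Set.univ)
    (fun z _ => (hu.differentiable (by simp)).differentiableAt) (fun z _ => h z) convex_univ
    trivial trivial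

theorem taylor_one {F : Type*} [NormedAddCommGroup F] [NormedSpace ℝ F] {u : E → F}
    (hu : ContDiff ℝ ∞ u) {M : ℝ}
    (h : ∀ x y, ‖fderiv ℝ u x - fderiv ℝ u y‖ ≤ M * ‖x - y‖) (hM : 0 ≤ M) (y v : E) :
    ‖u (y + v) - u y - fderiv ℝ u y v‖ ≤ M * ‖v‖ ^ 2 := by
  have key := Convex.norm_image_sub_le_of_norm_hasFDerivWithin_le (𝕜 := ℝ)
    (f := fun z => u z - fderiv ℝ u y z) (f' := fun z => fderiv ℝ u z - fderiv ℝ u y)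
    (s := segment ℝ y (y + v)) (C := M * ‖v‖) (x := y) (y := y + v) ?_ ?_ (convex_segment _ _)
    (left_mem_segment _ _ _) (right_mem_segment _ _ _)
  · have e : u (y + v) - fderiv ℝ u y (y + v) - (u y - fderiv ℝ u y y)
        = u (y + v) - u y - fderiv ℝ u y v := by
      rw [map_add]; abel
    rw [e] at key
    simpa [pow_two, mul_assoc] using key
  · intro z _
    exact ((hu.differentiable (by simp)).differentiableAt.hasFDerivAt.sub
      (fderiv ℝ u y).hasFDerivAt).hasFDerivWithinAt
  · intro z hz
    refine (h z y).trans (mul_le_mul_of_nonneg_left ?_ hM)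
    rw [segment_eq_image'] at hz
    obtain ⟨t, ht, rfl⟩ := hz
    simp only [add_sub_cancel_left, norm_smul, Real.norm_eq_abs, abs_of_nonneg ht.1]
    exact mul_le_of_le_one_left (norm_nonneg _) ht.2

theorem Reg.nonneg {u : E → ℝ} {M : ℝ} (h : Reg u M) : 0 ≤ M := (norm_nonneg _).trans (h.d1 0)

theorem Drift.nonneg {b : E → E} {ρ L : ℝ} (h : Drift b ρ L) : 0 ≤ L :=
  (norm_nonneg _).trans (h.d1 0)

theorem Reg.taylor_one {u : E → ℝ} {M : ℝ} (h : Reg u M) (y v : E) :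
    |u (y + v) - u y - fderiv ℝ u y v| ≤ M * ‖v‖ ^ 2 :=
  PhiSobolev.taylor_one h.contDiff (lipschitz_of_fderiv (fderiv_contDiff h.contDiff) h.d2)
    h.nonneg y v

theorem Reg.taylor_two {u : E → ℝ} {M : ℝ} (h : Reg u M) (y v : E) :
    |u (y + v) - u y - fderiv ℝ u y v - (1 / 2) * fderiv ℝ (fderiv ℝ u) y v v|
      ≤ M * ‖v‖ ^ 3 := by
  have hM := h.nonneg
  have hd : ∀ z, HasFDerivAt u (fderiv ℝ u z) z := fun z =>
    (h.contDiff.differentiable (by simp)).differentiableAt.hasFDerivAt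
  have hline : ∀ t : ℝ, HasDerivAt (fun t : ℝ => u (y + t • v)) (fderiv ℝ u (y + t • v) v) t := by
    intro t
    have h1 : HasDerivAt (fun t : ℝ => y + t • v) v t := by
      simpa using ((hasDerivAt_id t).smul_const v).const_add y
    exact (hd _).comp_hasDerivAt t h1
  have key := Convex.norm_image_sub_le_of_norm_hasDerivWithin_le
    (f := fun t : ℝ => u (y + t • v) - t * fderiv ℝ u y v
      - (1 / 2) * t ^ 2 * fderiv ℝ (fderiv ℝ u) y v v)
    (f' := fun t : ℝ => fderiv ℝ u (y + t • v) v - fderiv ℝ u y v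
      - t * fderiv ℝ (fderiv ℝ u) y v v)
    (s := Set.Icc (0 : ℝ) 1) (C := M * ‖v‖ ^ 3) (x := 0) (y := 1) ?_ ?_ (convex_Icc 0 1)
    (by simp) (by simp)
  · simp only [Real.norm_eq_abs] at key
    convert key using 1
    · congr 1
      simp
      ring
    · simp
  · intro t _
    have h2 : HasDerivAt (fun t : ℝ => t * fderiv ℝ u y v) (fderiv ℝ u y v) t := by
      simpa using (hasDerivAt_id t).mul_const (fderiv ℝ u y v)
    have h3 : HasDerivAt (fun t : ℝ => (1 / 2) * t ^ 2 * fderiv ℝ (fderiv ℝ u) y v v)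
        (t * fderiv ℝ (fderiv ℝ u) y v v) t := by
      refine (((hasDerivAt_pow 2 t).const_mul (1 / 2 : ℝ)).mul_const
        (fderiv ℝ (fderiv ℝ u) y v v)).congr_deriv ?_
      simp
    exact (((hline t).sub h2).sub h3).hasDerivWithinAt
  · intro t ht
    have h4 := PhiSobolev.taylor_one (fderiv_contDiff h.contDiff) h.d3 hM y (t • v)
    have e : fderiv ℝ u (y + t • v) v - fderiv ℝ u y v - t * fderiv ℝ (fderiv ℝ u) y v v
        = (fderiv ℝ u (y + t • v) - fderiv ℝ u y - fderiv ℝ (fderiv ℝ u) y (t • v)) v := by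
      simp
    rw [e]
    refine (ContinuousLinearMap.le_of_opNorm_le _ h4 v).trans ?_
    rw [norm_smul, Real.norm_eq_abs, abs_of_nonneg ht.1]
    have : t ^ 2 ≤ 1 := pow_le_one₀ ht.1 ht.2
    calc M * (t * ‖v‖) ^ 2 * ‖v‖ = t ^ 2 * (M * ‖v‖ ^ 3) := by ring
      _ ≤ 1 * (M * ‖v‖ ^ 3) := by gcongr
      _ = _ := one_mul _

section comp

variable {b : E → E} {ρ L h : ℝ}

theorem Drift.hasFDerivAt_step (hb : Drift b ρ L) (x : E) :
    HasFDerivAt (fun x => x - h • b x) (ContinuousLinearMap.id ℝ E - h • fderiv ℝ b x) x :=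
  (hasFDerivAt_id x).sub
    ((hb.contDiff.differentiable (by simp)).differentiableAt.hasFDerivAt.const_smul h)

theorem Drift.norm_step_le (hb : Drift b ρ L) (hh : 0 ≤ h) {q : ℝ} (hq : 0 ≤ q)
    (hq2 : 1 - 2 * ρ * h + h ^ 2 * L ^ 2 ≤ q ^ 2) (x : E) :
    ‖ContinuousLinearMap.id ℝ E - h • fderiv ℝ b x‖ ≤ q := by
  refine ContinuousLinearMap.opNorm_le_bound _ hq fun y => ?_
  refine le_of_sq_le_sq ?_ (by positivity)
  have h1 := hb.mono x y
  have h2 : ‖fderiv ℝ b x y‖ ≤ L * ‖y‖ := ContinuousLinearMap.le_of_opNorm_le _ (hb.d1 x) y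
  have h3 : ‖fderiv ℝ b x y‖ ^ 2 ≤ L ^ 2 * ‖y‖ ^ 2 := by
    rw [← mul_pow]; gcongr
  simp only [_root_.sub_apply, ContinuousLinearMap.id_apply,
    _root_.smul_apply]
  rw [norm_sub_sq_real, inner_smul_right, norm_smul, real_inner_comm, Real.norm_eq_abs,
    abs_of_nonneg hh]
  calc _ ≤ ‖y‖ ^ 2 - 2 * (h * (ρ * ‖y‖ ^ 2)) + h ^ 2 * (L ^ 2 * ‖y‖ ^ 2) := by
        rw [mul_pow]; gcongr
    _ = (1 - 2 * ρ * h + h ^ 2 * L ^ 2) * ‖y‖ ^ 2 := by ring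
    _ ≤ q ^ 2 * ‖y‖ ^ 2 := by gcongr
    _ = _ := by ring

theorem Drift.fderiv_comp (hb : Drift b ρ L) {u : E → ℝ} (hu : ContDiff ℝ ∞ u) (x : E) :
    fderiv ℝ (fun x => u (x - h • b x)) x
      = (fderiv ℝ u (x - h • b x)).comp (ContinuousLinearMap.id ℝ E - h • fderiv ℝ b x) :=
  ((hu.differentiable (by simp)).differentiableAt.hasFDerivAt.comp x
    (hb.hasFDerivAt_step x)).fderiv

theorem Drift.fderiv_fderiv_comp (hb : Drift b ρ L) {u : E → ℝ} (hu : ContDiff ℝ ∞ u)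
    (x y z : E) :
    fderiv ℝ (fderiv ℝ (fun x => u (x - h • b x))) x y z
      = fderiv ℝ (fderiv ℝ u) (x - h • b x) (y - h • fderiv ℝ b x y) (z - h • fderiv ℝ b x z)
        - h * fderiv ℝ u (x - h • b x) (fderiv ℝ (fderiv ℝ b) x y z) := by
  have e : fderiv ℝ (fun x => u (x - h • b x)) = fun x =>
      (fderiv ℝ u (x - h • b x)).comp (ContinuousLinearMap.id ℝ E - h • fderiv ℝ b x) :=
    funext fun x => hb.fderiv_comp hu x
  have h1 : HasFDerivAt (fun x => fderiv ℝ u (x - h • b x)) _ x :=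
    ((fderiv_contDiff hu).differentiable (by simp)).differentiableAt.hasFDerivAt.comp x
      (hb.hasFDerivAt_step x)
  have h2 : HasFDerivAt (fun x => ContinuousLinearMap.id ℝ E - h • fderiv ℝ b x) _ x :=
    (((fderiv_contDiff hb.contDiff).differentiable (by simp)).differentiableAt.hasFDerivAt.const_smul
      h).const_sub (ContinuousLinearMap.id ℝ E)
  rw [e, (h1.clm_comp h2).fderiv]
  simp
  ring

theorem Drift.reg_comp (hb : Drift b ρ L) (hh : 0 ≤ h) 
    (hq2 : 1 - 2 * ρ * h + h ^ 2 * L ^ 2 ≤ 1) {u : E → ℝ} {M : ℝ} (hu : Reg u M) :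
    Reg (fun x => u (x - h • b x)) ((1 + 4 * L * h) * M) := by
  have hM := hu.nonneg
  have hL := hb.nonneg
  have hA : ∀ x y, ‖y - h • fderiv ℝ b x y‖ ≤ ‖y‖ := fun x y => by
    have := ContinuousLinearMap.le_of_opNorm_le _
      (hb.norm_step_le hh zero_le_one (by simpa using hq2) x) y
    simpa using this
  have hT : ∀ x y, ‖(x - h • b x) - (y - h • b y)‖ ≤ ‖x - y‖ := fun x y => by
    have := lipschitz_of_fderiv (u := fun x => x - h • b x)
      (contDiff_id.sub (contDiff_const.smul hb.contDiff)) (M := 1)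
      (fun x => by
        rw [(hb.hasFDerivAt_step x).fderiv]
        exact hb.norm_step_le hh zero_le_one (by simpa using hq2) x) x y
    simpa using this
  have hbil : ∀ (B : E →L[ℝ] E →L[ℝ] ℝ) (K : ℝ), ‖B‖ ≤ K → ∀ x y, |B x y| ≤ K * ‖x‖ * ‖y‖ :=
    fun B K hK x y => (B.le_opNorm₂ x y).trans (by gcongr)
  have hdd : ∀ x y z, ‖fderiv ℝ (fderiv ℝ b) x y z‖ ≤ L * ‖y‖ * ‖z‖ := fun x y z =>
    ((fderiv ℝ (fderiv ℝ b) x).le_opNorm₂ y z).trans (by gcongr; exact hb.d2 x)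
  have hle : M ≤ (1 + 4 * L * h) * M := by
    nlinarith [mul_nonneg (mul_nonneg hL hh) hM]
  refine ⟨hu.contDiff.comp (contDiff_id.sub (contDiff_const.smul hb.contDiff)), fun x => ?_,
    fun x => ?_, fun x x' => ?_⟩
  · rw [hb.fderiv_comp hu.contDiff]
    refine (ContinuousLinearMap.opNorm_comp_le _ _).trans ?_
    calc _ ≤ M * 1 := by
          gcongr
          · exact hu.d1 _
          · exact hb.norm_step_le hh zero_le_one (by simpa using hq2) x
      _ ≤ _ := by simpa using hle
  · refine ContinuousLinearMap.opNorm_le_bound₂ _ (by positivity) fun y z => ?_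
    rw [hb.fderiv_fderiv_comp hu.contDiff, Real.norm_eq_abs]
    refine (abs_sub _ _).trans ?_
    have h1 := hbil _ M (hu.d2 (x - h • b x)) (y - h • fderiv ℝ b x y) (z - h • fderiv ℝ b x z)
    have h2 : |h * fderiv ℝ u (x - h • b x) (fderiv ℝ (fderiv ℝ b) x y z)|
        ≤ h * (M * (L * ‖y‖ * ‖z‖)) := by
      rw [abs_mul, abs_of_nonneg hh]
      gcongr
      exact (ContinuousLinearMap.le_of_opNorm_le _ (hu.d1 _) _).trans (by gcongr; exact hdd x y z)
    calc _ ≤ M * ‖y‖ * ‖z‖ + h * (M * (L * ‖y‖ * ‖z‖)) := by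
          refine add_le_add (h1.trans ?_) h2
          gcongr
          exacts [hA _ _, hA _ _]
      _ ≤ M * ‖y‖ * ‖z‖ + 4 * (h * (M * (L * ‖y‖ * ‖z‖))) := by
          have : 0 ≤ h * (M * (L * ‖y‖ * ‖z‖)) := by positivity
          linarith
      _ = _ := by ring
  · refine ContinuousLinearMap.opNorm_le_bound₂ _ (by positivity) fun y z => ?_
    rw [_root_.sub_apply, _root_.sub_apply,
      hb.fderiv_fderiv_comp hu.contDiff, hb.fderiv_fderiv_comp hu.contDiff, Real.norm_eq_abs]
    set X := x - h • b x with hX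
    set X' := x' - h • b x' with hX'
    set Y := y - h • fderiv ℝ b x y with hY
    set Y' := y - h • fderiv ℝ b x' y with hY'
    set Z := z - h • fderiv ℝ b x z with hZ
    set Z' := z - h • fderiv ℝ b x' z with hZ'
    have hXX : ‖X - X'‖ ≤ ‖x - x'‖ := hT x x'
    have hlip : ∀ y, ‖(y - h • fderiv ℝ b x y) - (y - h • fderiv ℝ b x' y)‖
        ≤ h * (L * ‖x - x'‖ * ‖y‖) := fun y => by
      have e : (y - h • fderiv ℝ b x y) - (y - h • fderiv ℝ b x' y)
          = - (h • ((fderiv ℝ b x - fderiv ℝ b x') y)) := by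
        simp [smul_sub]
      rw [e, norm_neg, norm_smul, Real.norm_eq_abs, abs_of_nonneg hh]
      gcongr
      exact ContinuousLinearMap.le_of_opNorm_le _
        (lipschitz_of_fderiv (fderiv_contDiff hb.contDiff) hb.d2 x x') y
    have e : fderiv ℝ (fderiv ℝ u) X Y Z - h * fderiv ℝ u X (fderiv ℝ (fderiv ℝ b) x y z)
        - (fderiv ℝ (fderiv ℝ u) X' Y' Z'
          - h * fderiv ℝ u X' (fderiv ℝ (fderiv ℝ b) x' y z))
        = (fderiv ℝ (fderiv ℝ u) X - fderiv ℝ (fderiv ℝ u) X') Y Z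
          + fderiv ℝ (fderiv ℝ u) X' (Y - Y') Z + fderiv ℝ (fderiv ℝ u) X' Y' (Z - Z')
          - h * ((fderiv ℝ u X - fderiv ℝ u X') (fderiv ℝ (fderiv ℝ b) x y z))
          - h * (fderiv ℝ u X'
            ((fderiv ℝ (fderiv ℝ b) x - fderiv ℝ (fderiv ℝ b) x') y z)) := by
      simp
      ring
    rw [e]
    have t1 : |(fderiv ℝ (fderiv ℝ u) X - fderiv ℝ (fderiv ℝ u) X') Y Z|
        ≤ M * ‖x - x'‖ * ‖y‖ * ‖z‖ := by
      refine (hbil _ _ ((hu.d3 X X').trans (mul_le_mul_of_nonneg_left hXX hM)) Y Z).trans ?_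
      gcongr
      exacts [hA _ _, hA _ _]
    have t2 : |fderiv ℝ (fderiv ℝ u) X' (Y - Y') Z| ≤ M * (h * (L * ‖x - x'‖ * ‖y‖)) * ‖z‖ := by
      refine (hbil _ _ (hu.d2 X') (Y - Y') Z).trans ?_
      gcongr
      exacts [hlip y, hA _ _]
    have t3 : |fderiv ℝ (fderiv ℝ u) X' Y' (Z - Z')|
        ≤ M * ‖y‖ * (h * (L * ‖x - x'‖ * ‖z‖)) := by
      refine (hbil _ _ (hu.d2 X') Y' (Z - Z')).trans ?_
      gcongr
      exacts [hA _ _, hlip z]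
    have t4 : |h * ((fderiv ℝ u X - fderiv ℝ u X') (fderiv ℝ (fderiv ℝ b) x y z))|
        ≤ h * (M * ‖x - x'‖ * (L * ‖y‖ * ‖z‖)) := by
      rw [abs_mul, abs_of_nonneg hh]
      gcongr
      refine (ContinuousLinearMap.le_of_opNorm_le _ ((lipschitz_of_fderiv
        (fderiv_contDiff hu.contDiff) hu.d2 X X').trans
          (mul_le_mul_of_nonneg_left hXX hM)) _).trans ?_
      gcongr
      exact hdd x y z
    have t5 : |h * (fderiv ℝ u X' ((fderiv ℝ (fderiv ℝ b) x - fderiv ℝ (fderiv ℝ b) x') y z))|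
        ≤ h * (M * (L * ‖x - x'‖ * ‖y‖ * ‖z‖)) := by
      rw [abs_mul, abs_of_nonneg hh]
      gcongr
      refine (ContinuousLinearMap.le_of_opNorm_le _ (hu.d1 X') _).trans ?_
      gcongr
      refine (ContinuousLinearMap.le_opNorm₂ _ y z).trans ?_
      gcongr
      exact hb.d3 x x'
    calc _ ≤ M * ‖x - x'‖ * ‖y‖ * ‖z‖ + M * (h * (L * ‖x - x'‖ * ‖y‖)) * ‖z‖
          + M * ‖y‖ * (h * (L * ‖x - x'‖ * ‖z‖)) + h * (M * ‖x - x'‖ * (L * ‖y‖ * ‖z‖))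
          + h * (M * (L * ‖x - x'‖ * ‖y‖ * ‖z‖)) := by
          refine (abs_sub _ _).trans (add_le_add ((abs_sub _ _).trans (add_le_add
            ((abs_add_le _ _).trans (add_le_add ((abs_add_le _ _).trans (add_le_add t1 t2)) t3))
              t4)) t5)
      _ = _ := by ring

end comp

end PhiSobolev

namespace PhiSobolev

open scoped ContDiff

variable {E : Type*} [NormedAddCommGroup E] [InnerProductSpace ℝ E]
variable {ι : Type*} [Fintype ι] {d : ℕ}

/-- A centred isotropic finitely supported random vector, with weights `w` and values `η`. -/
structure Noise (e : OrthonormalBasis (Fin d) ℝ E) (w : ι → ℝ) (η : ι → E) (N : ℝ) : Prop where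
  nonneg : ∀ j, 0 ≤ w j
  sum_one : ∑ j, w j = 1
  mean : ∀ l : E →L[ℝ] ℝ, ∑ j, w j * l (η j) = 0
  cov : ∀ B : E →L[ℝ] E →L[ℝ] ℝ, ∑ j, w j * B (η j) (η j) = ∑ i, B (e i) (e i)
  norm_le : ∀ j, ‖η j‖ ≤ N
  one_le : 1 ≤ N

/-- Averaging over the noise scaled by `s`. -/
def avg (w : ι → ℝ) (η : ι → E) (s : ℝ) (u : E → ℝ) (y : E) : ℝ := ∑ j, w j * u (y + s • η j)

/-- One step of the Euler scheme with drift `-b` and time step `h`. -/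
noncomputable def step (b : E → E) (w : ι → ℝ) (η : ι → E) (h : ℝ) (u : E → ℝ) (x : E) : ℝ :=
  avg w η (Real.sqrt (2 * h)) u (x - h • b x)

theorem Reg.mono {u : E → ℝ} {M M' : ℝ} (hu : Reg u M) (h : M ≤ M') : Reg u M' :=
  ⟨hu.contDiff, fun x => (hu.d1 x).trans h, fun x => (hu.d2 x).trans h,
    fun x y => (hu.d3 x y).trans (by gcongr)⟩

variable {e : OrthonormalBasis (Fin d) ℝ E} {w : ι → ℝ} {η : ι → E} {N : ℝ}

theorem Noise.avg_mono (hn : Noise e w η N) {s : ℝ} {u v : E → ℝ} (h : ∀ x, u x ≤ v x) (y : E) :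
    avg w η s u y ≤ avg w η s v y :=
  Finset.sum_le_sum fun j _ => mul_le_mul_of_nonneg_left (h _) (hn.nonneg j)

theorem Noise.avg_le (hn : Noise e w η N) {s c : ℝ} {u : E → ℝ} {y : E}
    (h : ∀ j, u (y + s • η j) ≤ c) : avg w η s u y ≤ c := by
  calc _ ≤ ∑ j, w j * c :=
        Finset.sum_le_sum fun j _ => mul_le_mul_of_nonneg_left (h _) (hn.nonneg j)
    _ = c := by rw [← Finset.sum_mul, hn.sum_one, one_mul]

theorem avg_add {s : ℝ} (u v : E → ℝ) (y : E) :
    avg w η s (fun x => u x + v x) y = avg w η s u y + avg w η s v y := by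
  simp [avg, mul_add, Finset.sum_add_distrib]

theorem avg_const_mul {s c : ℝ} (u : E → ℝ) (y : E) :
    avg w η s (fun x => c * u x) y = c * avg w η s u y := by
  simp only [avg, Finset.mul_sum]
  exact Finset.sum_congr rfl fun j _ => by ring

theorem Noise.avg_const (hn : Noise e w η N) {s c : ℝ} (y : E) :
    avg w η s (fun _ => c) y = c := by
  rw [avg, ← Finset.sum_mul, hn.sum_one, one_mul]

theorem Noise.norm_weighted_sum_le (hn : Noise e w η N) {F : Type*} [NormedAddCommGroup F]
    [NormedSpace ℝ F] {v : ι → F} {c : ℝ} (h : ∀ j, ‖v j‖ ≤ c) : ‖∑ j, w j • v j‖ ≤ c := by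
  refine (_root_.norm_sum_le _ _).trans ?_
  calc _ ≤ ∑ j, w j * c := Finset.sum_le_sum fun j _ => by
        rw [norm_smul, Real.norm_eq_abs, abs_of_nonneg (hn.nonneg j)]
        exact mul_le_mul_of_nonneg_left (h _) (hn.nonneg j)
    _ = c := by rw [← Finset.sum_mul, hn.sum_one, one_mul]

theorem hasFDerivAt_sum_smul_add {F : Type*} [NormedAddCommGroup F] [NormedSpace ℝ F] {u : E → F}
    (hu : ContDiff ℝ ∞ u) (s : ℝ) (y : E) :
    HasFDerivAt (fun y => ∑ j, w j • u (y + s • η j)) (∑ j, w j • fderiv ℝ u (y + s • η j)) y := by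
  refine HasFDerivAt.fun_sum fun j _ => HasFDerivAt.const_smul ?_ _
  exact (hasFDerivAt_comp_add_right (s • η j)).mpr
    (hu.differentiable (by simp)).differentiableAt.hasFDerivAt

theorem fderiv_avg {u : E → ℝ} (hu : ContDiff ℝ ∞ u) (s : ℝ) :
    fderiv ℝ (avg w η s u) = fun y => ∑ j, w j • fderiv ℝ u (y + s • η j) :=
  funext fun y => (hasFDerivAt_sum_smul_add hu s y).fderiv

theorem fderiv_fderiv_avg {u : E → ℝ} (hu : ContDiff ℝ ∞ u) (s : ℝ) :
    fderiv ℝ (fderiv ℝ (avg w η s u))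
      = fun y => ∑ j, w j • fderiv ℝ (fderiv ℝ u) (y + s • η j) := by
  rw [fderiv_avg hu]
  exact funext fun y => (hasFDerivAt_sum_smul_add (fderiv_contDiff hu) s y).fderiv

theorem Noise.reg_avg (hn : Noise e w η N) {u : E → ℝ} {M : ℝ} (hu : Reg u M) (s : ℝ) :
    Reg (avg w η s u) M := by
  refine ⟨?_, fun x => ?_, fun x => ?_, fun x y => ?_⟩
  · exact ContDiff.sum fun j _ => contDiff_const.mul
      (hu.contDiff.comp (contDiff_id.add contDiff_const))
  · rw [fderiv_avg hu.contDiff]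
    exact hn.norm_weighted_sum_le fun j => hu.d1 _
  · rw [fderiv_fderiv_avg hu.contDiff]
    exact hn.norm_weighted_sum_le (F := E →L[ℝ] E →L[ℝ] ℝ) fun j => hu.d2 _
  · rw [fderiv_fderiv_avg hu.contDiff]
    rw [← Finset.sum_sub_distrib]
    have e1 : ∀ j, w j • fderiv ℝ (fderiv ℝ u) (x + s • η j)
        - w j • fderiv ℝ (fderiv ℝ u) (y + s • η j)
        = w j • (fderiv ℝ (fderiv ℝ u) (x + s • η j) - fderiv ℝ (fderiv ℝ u) (y + s • η j)) :=
      fun j => (smul_sub _ _ _).symm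
    rw [Finset.sum_congr rfl fun j _ => e1 j]
    refine hn.norm_weighted_sum_le (F := E →L[ℝ] E →L[ℝ] ℝ) fun j => (hu.d3 _ _).trans_eq ?_
    rw [add_sub_add_right_eq_sub]

theorem Noise.norm_fderiv_avg_le (hn : Noise e w η N) {u : E → ℝ} (hu : ContDiff ℝ ∞ u)
    (s : ℝ) (y : E) : ‖fderiv ℝ (avg w η s u) y‖ ≤ avg w η s (fun x => ‖fderiv ℝ u x‖) y := by
  rw [fderiv_avg hu]
  refine (_root_.norm_sum_le _ _).trans_eq (Finset.sum_congr rfl fun j _ => ?_)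
  rw [norm_smul, Real.norm_eq_abs, abs_of_nonneg (hn.nonneg j)]

theorem sum_sq_eq_norm_sq [CompleteSpace E] (e : OrthonormalBasis (Fin d) ℝ E) (l : E →L[ℝ] ℝ) :
    ∑ i, l (e i) ^ 2 = ‖l‖ ^ 2 := by
  rw [← (InnerProductSpace.toDual ℝ E).symm.norm_map l, ← e.sum_sq_norm_inner_left]
  refine Finset.sum_congr rfl fun i _ => ?_
  rw [InnerProductSpace.toDual_symm_apply]
  simp

theorem Noise.sum_sq [CompleteSpace E] (hn : Noise e w η N) (l : E →L[ℝ] ℝ) :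
    ∑ j, w j * l (η j) ^ 2 = ‖l‖ ^ 2 := by
  rw [← sum_sq_eq_norm_sq e l]
  have := hn.cov (l.smulRight l)
  simpa [pow_two] using this

theorem Noise.variance_le (hn : Noise e w η N) (g : ι → ℝ) (c : ℝ) :
    ∑ j, w j * (g j - ∑ k, w k * g k) ^ 2 ≤ ∑ j, w j * (g j - c) ^ 2 := by
  set m := ∑ k, w k * g k with hm
  have e1 : ∑ j, w j * (g j - c) ^ 2
      = ∑ j, w j * (g j - m) ^ 2 + 2 * (m - c) * (∑ j, w j * g j - m * ∑ j, w j)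
        + (m - c) ^ 2 * ∑ j, w j := by
    simp only [Finset.mul_sum, ← Finset.sum_add_distrib, ← Finset.sum_sub_distrib]
    exact Finset.sum_congr rfl fun j _ => by ring
  rw [e1, ← hm, hn.sum_one]
  nlinarith [sq_nonneg (m - c)]

/-- Second moment of the increments of a regular function along the noise. -/
theorem Noise.sum_increment_sq_le [CompleteSpace E] (hn : Noise e w η N) {g : E → ℝ} {M : ℝ}
    (hg : Reg g M) {s : ℝ} (hs : 0 ≤ s) (hs1 : s ≤ 1) (y : E) :
    ∑ j, w j * (g (y + s • η j) - g y) ^ 2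
      ≤ s ^ 2 * avg w η s (fun x => ‖fderiv ℝ g x‖) y ^ 2 + 5 * s ^ 3 * M ^ 2 * N ^ 4 := by
  have hM := hg.nonneg
  have hN := hn.one_le
  have hN0 : 0 ≤ N := by linarith
  set G := avg w η s (fun x => ‖fderiv ℝ g x‖) y with hG
  have hsη : ∀ j, ‖s • η j‖ ≤ s * N := fun j => by
    rw [norm_smul, Real.norm_eq_abs, abs_of_nonneg hs]
    exact mul_le_mul_of_nonneg_left (hn.norm_le j) hs
  have hGM : G ≤ M := hn.avg_le fun j => hg.d1 _
  have hG0 : 0 ≤ G := Finset.sum_nonneg fun j _ => mul_nonneg (hn.nonneg j) (norm_nonneg _)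
  have hDG : ‖fderiv ℝ g y‖ ≤ G + M * (s * N) := by
    have h1 : avg w η s (fun _ => ‖fderiv ℝ g y‖ - M * (s * N)) y ≤ G := by
      refine Finset.sum_le_sum fun j _ => mul_le_mul_of_nonneg_left ?_ (hn.nonneg j)
      have h2 := lipschitz_of_fderiv (fderiv_contDiff hg.contDiff) hg.d2 y (y + s • η j)
      have h3 : ‖y - (y + s • η j)‖ ≤ s * N := by
        rw [sub_add_cancel_left, norm_neg]; exact hsη j
      have h4 := norm_sub_norm_le (fderiv ℝ g y) (fderiv ℝ g (y + s • η j))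
      have h5 := mul_le_mul_of_nonneg_left h3 hM
      linarith
    rw [hn.avg_const] at h1
    linarith
  have hpt : ∀ j, (g (y + s • η j) - g y) ^ 2
      ≤ s ^ 2 * fderiv ℝ g y (η j) ^ 2 + 3 * s ^ 3 * M ^ 2 * N ^ 4 := fun j => by
    have h1 := hg.taylor_one y (s • η j)
    have h2 : |fderiv ℝ g y (s • η j)| ≤ M * (s * N) :=
      (ContinuousLinearMap.le_of_opNorm_le _ (hg.d1 y) _).trans
        (mul_le_mul_of_nonneg_left (hsη j) hM)
    have h3 : M * ‖s • η j‖ ^ 2 ≤ M * (s * N) ^ 2 := by gcongr; exact hsη j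
    rw [map_smul, smul_eq_mul] at h1 h2
    set X := s * fderiv ℝ g y (η j)
    set R := g (y + s • η j) - g y - X
    have e1 : g (y + s • η j) - g y = X + R := by simp [R]
    have hR : |R| ≤ M * (s * N) ^ 2 := h1.trans h3
    have h4 : X * R ≤ M * (s * N) * (M * (s * N) ^ 2) := by
      refine (le_abs_self _).trans ?_
      rw [abs_mul]; gcongr
    have h5 : R ^ 2 ≤ (M * (s * N) ^ 2) ^ 2 := by
      rw [← sq_abs]; gcongr
    have h6 : M * (s * N) * (M * (s * N) ^ 2) ≤ s ^ 3 * M ^ 2 * N ^ 4 := by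
      calc _ = s ^ 3 * M ^ 2 * N ^ 3 := by ring
        _ ≤ _ := by gcongr; norm_num
    have h7 : (M * (s * N) ^ 2) ^ 2 ≤ s ^ 3 * M ^ 2 * N ^ 4 := by
      have : s ^ 4 ≤ s ^ 3 := pow_le_pow_of_le_one hs hs1 (by norm_num)
      calc _ = s ^ 4 * M ^ 2 * N ^ 4 := by ring
        _ ≤ _ := by gcongr
    rw [e1]
    calc (X + R) ^ 2 = X ^ 2 + 2 * (X * R) + R ^ 2 := by ring
      _ ≤ X ^ 2 + 2 * (s ^ 3 * M ^ 2 * N ^ 4) + s ^ 3 * M ^ 2 * N ^ 4 := by linarith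
      _ = _ := by simp only [X]; ring
  have hsum : ∑ j, w j * (g (y + s • η j) - g y) ^ 2
      ≤ s ^ 2 * ‖fderiv ℝ g y‖ ^ 2 + 3 * s ^ 3 * M ^ 2 * N ^ 4 := by
    calc _ ≤ ∑ j, w j * (s ^ 2 * fderiv ℝ g y (η j) ^ 2 + 3 * s ^ 3 * M ^ 2 * N ^ 4) :=
          Finset.sum_le_sum fun j _ => mul_le_mul_of_nonneg_left (hpt j) (hn.nonneg j)
      _ = s ^ 2 * ∑ j, w j * fderiv ℝ g y (η j) ^ 2
          + (∑ j, w j) * (3 * s ^ 3 * M ^ 2 * N ^ 4) := by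
          rw [Finset.mul_sum, Finset.sum_mul, ← Finset.sum_add_distrib]
          exact Finset.sum_congr rfl fun j _ => by ring
      _ = _ := by rw [hn.sum_sq, hn.sum_one, one_mul]
  have hD2 : ‖fderiv ℝ g y‖ ^ 2 ≤ G ^ 2 + 2 * s * M ^ 2 * N := by
    have h1 := hg.d1 y
    have h0 := norm_nonneg (fderiv ℝ g y)
    nlinarith [mul_le_mul_of_nonneg_right (sub_le_iff_le_add'.mpr hDG)
      (add_nonneg h0 hG0), mul_le_mul_of_nonneg_left (add_le_add h1 hGM)
        (mul_nonneg hM (mul_nonneg hs hN0))]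
  have h8 : s ^ 3 * M ^ 2 * N ≤ s ^ 3 * M ^ 2 * N ^ 4 := by
    gcongr
    exact le_self_pow₀ hN (by norm_num)
  calc _ ≤ s ^ 2 * (G ^ 2 + 2 * s * M ^ 2 * N) + 3 * s ^ 3 * M ^ 2 * N ^ 4 := by
        refine hsum.trans ?_
        gcongr
    _ = s ^ 2 * G ^ 2 + 2 * (s ^ 3 * M ^ 2 * N) + 3 * s ^ 3 * M ^ 2 * N ^ 4 := by ring
    _ ≤ _ := by linarith

/-- Functions `Φ` on `J` with nonnegative second derivative `Φ₂` such that `Φ₂(u) v²` is convex. -/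
structure Admissible (Φ Φ₁ Φ₂ : ℝ → ℝ) (J : Set ℝ) (K : ℝ) : Prop where
  convex : Convex ℝ J
  nonneg : ∀ p ∈ J, 0 ≤ Φ₂ p
  le : ∀ p ∈ J, Φ₂ p ≤ K
  conv : ConvexOn ℝ (J ×ˢ (Set.univ : Set ℝ)) (fun p : ℝ × ℝ => Φ₂ p.1 * p.2 ^ 2)
  taylor : ∀ τ > 0, ∃ δ > 0, ∀ p ∈ J, ∀ r ∈ J, |r - p| ≤ δ →
    Φ r ≤ Φ p + Φ₁ p * (r - p) + (1 / 2) * (Φ₂ p + τ) * (r - p) ^ 2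

variable {Φ Φ₁ Φ₂ : ℝ → ℝ} {J : Set ℝ} {K : ℝ}

theorem Noise.avg_mem (hn : Noise e w η N) (hJ : Convex ℝ J) {s : ℝ} {g : E → ℝ}
    (hg : ∀ x, g x ∈ J) (y : E) : avg w η s g y ∈ J :=
  hJ.sum_mem (fun j _ => hn.nonneg j) hn.sum_one fun _ _ => hg _

theorem Noise.jensen (hn : Noise e w η N) (hΦ : Admissible Φ Φ₁ Φ₂ J K) {s : ℝ} {g G : E → ℝ}
    (hg : ∀ x, g x ∈ J) (y : E) :
    Φ₂ (avg w η s g y) * avg w η s G y ^ 2 ≤ avg w η s (fun x => Φ₂ (g x) * G x ^ 2) y := by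
  have := hΦ.conv.map_sum_le (t := Finset.univ) (w := w)
    (p := fun j => ((g (y + s • η j), G (y + s • η j)) : ℝ × ℝ))
    (fun j _ => hn.nonneg j) hn.sum_one (fun j _ => ⟨hg _, trivial⟩)
  simpa [Prod.fst_sum, Prod.snd_sum, avg] using this

/-- Small-time `Φ`-entropy estimate for the noise. -/
theorem Noise.entropy_le [CompleteSpace E] (hn : Noise e w η N) (hΦ : Admissible Φ Φ₁ Φ₂ J K)
    {τ δ : ℝ} (hτ : 0 < τ)
    (hT : ∀ p ∈ J, ∀ r ∈ J, |r - p| ≤ δ →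
      Φ r ≤ Φ p + Φ₁ p * (r - p) + (1 / 2) * (Φ₂ p + τ) * (r - p) ^ 2)
    {g : E → ℝ} {M : ℝ} (hg : Reg g M) (hgJ : ∀ x, g x ∈ J)
    {s : ℝ} (hs : 0 ≤ s) (hs1 : s ≤ 1) (hsδ : 2 * (M * (s * N)) ≤ δ) (y : E) :
    avg w η s (fun x => Φ (g x)) y ≤ Φ (avg w η s g y)
      + s ^ 2 / 2 * avg w η s (fun x => Φ₂ (g x) * ‖fderiv ℝ g x‖ ^ 2) y
      + s ^ 2 * (τ * M ^ 2 + 3 * (K + τ) * s * M ^ 2 * N ^ 4) := by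
  have hM := hg.nonneg
  have hN := hn.one_le
  have hN0 : 0 ≤ N := by linarith
  have hm := hn.avg_mem hΦ.convex hgJ (s := s) y
  set m := avg w η s g y with hmdef
  set G := avg w η s (fun x => ‖fderiv ℝ g x‖) y with hG
  have hGM : G ≤ M := hn.avg_le fun j => hg.d1 _
  have hG0 : 0 ≤ G := Finset.sum_nonneg fun j _ => mul_nonneg (hn.nonneg j) (norm_nonneg _)
  have hΦ0 := hΦ.nonneg m hm
  have hΦK := hΦ.le m hm
  have hsη : ∀ j, ‖s • η j‖ ≤ s * N := fun j => by
    rw [norm_smul, Real.norm_eq_abs, abs_of_nonneg hs]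
    exact mul_le_mul_of_nonneg_left (hn.norm_le j) hs
  have hinc : ∀ j, |g (y + s • η j) - g y| ≤ M * (s * N) := fun j => by
    have := lipschitz_of_fderiv hg.contDiff hg.d1 (y + s • η j) y
    rw [add_sub_cancel_left] at this
    exact this.trans (mul_le_mul_of_nonneg_left (hsη j) hM)
  have hmy : |g y - m| ≤ M * (s * N) := by
    rw [abs_sub_comm, abs_le]
    constructor
    · have h1 : g y - M * (s * N) ≤ m := by
        calc _ = avg w η s (fun _ => g y - M * (s * N)) y := (hn.avg_const y).symm
          _ ≤ m := Finset.sum_le_sum fun j _ => mul_le_mul_of_nonneg_left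
              (by have := (abs_le.mp (hinc j)).1; linarith) (hn.nonneg j)
      linarith
    · have h1 : m ≤ g y + M * (s * N) :=
        hn.avg_le fun j => by have := (abs_le.mp (hinc j)).2; linarith
      linarith
  have hclose : ∀ j, |g (y + s • η j) - m| ≤ δ := fun j => by
    have := abs_sub_le (g (y + s • η j)) (g y) m
    linarith [hinc j]
  have hsum := hn.sum_increment_sq_le hg hs hs1 y
  have hvar := hn.variance_le (fun j => g (y + s • η j)) (g y)
  rw [← hG] at hsum
  have hV : ∑ j, w j * (g (y + s • η j) - m) ^ 2
      ≤ s ^ 2 * G ^ 2 + 5 * s ^ 3 * M ^ 2 * N ^ 4 := hvar.trans hsum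
  have hJ := hn.jensen hΦ (s := s) (G := fun x => ‖fderiv ℝ g x‖) hgJ y
  rw [← hmdef, ← hG] at hJ
  calc _ ≤ ∑ j, w j * (Φ m + Φ₁ m * (g (y + s • η j) - m)
            + (1 / 2) * (Φ₂ m + τ) * (g (y + s • η j) - m) ^ 2) :=
        Finset.sum_le_sum fun j _ => mul_le_mul_of_nonneg_left
          (hT m hm _ (hgJ _) (hclose j)) (hn.nonneg j)
    _ = Φ m * ∑ j, w j + Φ₁ m * (∑ j, w j * g (y + s • η j) - m * ∑ j, w j)
          + (1 / 2) * (Φ₂ m + τ) * ∑ j, w j * (g (y + s • η j) - m) ^ 2 := by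
        simp only [Finset.mul_sum, ← Finset.sum_add_distrib, ← Finset.sum_sub_distrib]
        exact Finset.sum_congr rfl fun j _ => by ring
    _ = Φ m + (1 / 2) * (Φ₂ m + τ) * ∑ j, w j * (g (y + s • η j) - m) ^ 2 := by
        rw [hn.sum_one]
        have : ∑ j, w j * g (y + s • η j) = m := rfl
        rw [this]; ring
    _ ≤ Φ m + (1 / 2) * (Φ₂ m + τ) * (s ^ 2 * G ^ 2 + 5 * s ^ 3 * M ^ 2 * N ^ 4) := by
        gcongr
    _ = Φ m + s ^ 2 / 2 * (Φ₂ m * G ^ 2) + s ^ 2 * (τ / 2 * G ^ 2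
          + 5 / 2 * (Φ₂ m + τ) * s * M ^ 2 * N ^ 4) := by ring
    _ ≤ _ := by
        have h1 : τ / 2 * G ^ 2 ≤ τ * M ^ 2 := by gcongr; linarith
        have h2 : 5 / 2 * (Φ₂ m + τ) * s * M ^ 2 * N ^ 4 ≤ 3 * (K + τ) * s * M ^ 2 * N ^ 4 := by
          gcongr; norm_num
        gcongr

end PhiSobolev

namespace PhiSobolev

open scoped ContDiff
open Filter Topology

variable {E : Type*} [NormedAddCommGroup E] [InnerProductSpace ℝ E]
variable {ι : Type*} [Fintype ι] {d : ℕ}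
variable {e : OrthonormalBasis (Fin d) ℝ E} {w : ι → ℝ} {η : ι → E} {N : ℝ}
variable {b : E → E} {ρ L h : ℝ}

theorem Noise.iterate_mono (hn : Noise e w η N) {u v : E → ℝ} (huv : ∀ x, u x ≤ v x) (k : ℕ)
    (x : E) : (step b w η h)^[k] u x ≤ (step b w η h)^[k] v x := by
  induction k generalizing x with
  | zero => exact huv x
  | succ k ih =>
    rw [Function.iterate_succ_apply', Function.iterate_succ_apply']
    exact hn.avg_mono ih _

theorem Noise.step_affine (hn : Noise e w η N) (u v : E → ℝ) (a c : ℝ) (x : E) :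
    step b w η h (fun x => u x + a * v x + c) x
      = step b w η h u x + a * step b w η h v x + c := by
  simp only [step]
  rw [avg_add (fun x => u x + a * v x) (fun _ => c), avg_add u (fun x => a * v x), avg_const_mul,
    hn.avg_const]

theorem Noise.iterate_add_const (hn : Noise e w η N) (u : E → ℝ) (c : ℝ) (k : ℕ) (x : E) :
    (step b w η h)^[k] (fun x => u x + c) x = (step b w η h)^[k] u x + c := by
  induction k generalizing x with
  | zero => rfl
  | succ k ih =>
    rw [Function.iterate_succ_apply', Function.iterate_succ_apply', funext ih]
    simpa using hn.step_affine (b := b) (h := h) ((step b w η h)^[k] u) 0 0 c x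

theorem Noise.abs_iterate_sub_le (hn : Noise e w η N) {u v : E → ℝ} {c : ℝ}
    (huv : ∀ x, |u x - v x| ≤ c) (k : ℕ) (x : E) :
    |(step b w η h)^[k] u x - (step b w η h)^[k] v x| ≤ c := by
  have h1 := hn.iterate_mono (b := b) (h := h) (u := u) (v := fun x => v x + c)
    (fun x => by have := (abs_le.mp (huv x)).2; linarith) k x
  have h2 := hn.iterate_mono (b := b) (h := h) (u := v) (v := fun x => u x + c)
    (fun x => by have := (abs_le.mp (huv x)).1; linarith) k x
  rw [hn.iterate_add_const] at h1 h2
  rw [abs_le]; constructor <;> linarith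

theorem Noise.iterate_mem (hn : Noise e w η N) {J : Set ℝ} (hJ : Convex ℝ J) {g : E → ℝ}
    (hg : ∀ x, g x ∈ J) (k : ℕ) (x : E) : (step b w η h)^[k] g x ∈ J := by
  induction k generalizing x with
  | zero => exact hg x
  | succ k ih =>
    rw [Function.iterate_succ_apply']
    exact hn.avg_mem hJ ih _

theorem Noise.reg_step (hn : Noise e w η N) (hb : Drift b ρ L) (hh : 0 ≤ h)
    (hq : 1 - 2 * ρ * h + h ^ 2 * L ^ 2 ≤ 1) {u : E → ℝ} {M : ℝ} (hu : Reg u M) :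
    Reg (step b w η h u) ((1 + 4 * L * h) * M) :=
  hb.reg_comp hh hq (hn.reg_avg hu _)

theorem Noise.reg_iterate (hn : Noise e w η N) (hb : Drift b ρ L) (hh : 0 ≤ h)
    (hq : 1 - 2 * ρ * h + h ^ 2 * L ^ 2 ≤ 1) {u : E → ℝ} {M : ℝ} (hu : Reg u M) (k : ℕ) :
    Reg ((step b w η h)^[k] u) ((1 + 4 * L * h) ^ k * M) := by
  induction k with
  | zero => simpa using hu
  | succ k ih =>
    rw [Function.iterate_succ_apply', pow_succ', mul_assoc]
    exact hn.reg_step hb hh hq ih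

theorem Noise.norm_fderiv_step_le (hn : Noise e w η N) (hb : Drift b ρ L) (hh : 0 ≤ h)
    {q : ℝ} (hq0 : 0 ≤ q) (hq : 1 - 2 * ρ * h + h ^ 2 * L ^ 2 ≤ q ^ 2) {u : E → ℝ} {M : ℝ}
    (hu : Reg u M) (x : E) :
    ‖fderiv ℝ (step b w η h u) x‖ ≤ q * step b w η h (fun x => ‖fderiv ℝ u x‖) x := by
  have : step b w η h u = fun x => avg w η (Real.sqrt (2 * h)) u (x - h • b x) := rfl
  rw [this, hb.fderiv_comp (hn.reg_avg hu _).contDiff]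
  refine (ContinuousLinearMap.opNorm_comp_le _ _).trans ?_
  refine (mul_le_mul (hn.norm_fderiv_avg_le hu.contDiff _ _) (hb.norm_step_le hh hq0 hq x)
    (norm_nonneg _) ?_).trans_eq (mul_comm _ _)
  exact Finset.sum_nonneg fun j _ => mul_nonneg (hn.nonneg j) (norm_nonneg _)

theorem Noise.norm_fderiv_iterate_le (hn : Noise e w η N) (hb : Drift b ρ L) (hh : 0 ≤ h)
    {q : ℝ} (hq0 : 0 ≤ q) (hq1 : q ≤ 1) (hq : 1 - 2 * ρ * h + h ^ 2 * L ^ 2 ≤ q ^ 2)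
    {u : E → ℝ} {M : ℝ} (hu : Reg u M) (k : ℕ) (x : E) :
    ‖fderiv ℝ ((step b w η h)^[k] u) x‖ ≤ q ^ k * M := by
  induction k generalizing x with
  | zero => simpa using hu.d1 x
  | succ k ih =>
    rw [Function.iterate_succ_apply', pow_succ', mul_assoc]
    refine (hn.norm_fderiv_step_le hb hh hq0 hq
      (hn.reg_iterate hb hh (hq.trans (pow_le_one₀ hq0 hq1)) hu k) x).trans ?_
    exact mul_le_mul_of_nonneg_left (hn.avg_le fun j => ih _) hq0

section entropy

variable {Φ Φ₁ Φ₂ : ℝ → ℝ} {J : Set ℝ} {K : ℝ}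

theorem Noise.fisher_iterate_le (hn : Noise e w η N) (hb : Drift b ρ L) (hh : 0 ≤ h)
    {q : ℝ} (hq0 : 0 ≤ q) (hq1 : q ≤ 1) (hq : 1 - 2 * ρ * h + h ^ 2 * L ^ 2 ≤ q ^ 2)
    (hΦ : Admissible Φ Φ₁ Φ₂ J K) {f : E → ℝ} {M : ℝ} (hf : Reg f M) (hfJ : ∀ x, f x ∈ J)
    (k : ℕ) (x : E) :
    Φ₂ ((step b w η h)^[k] f x) * ‖fderiv ℝ ((step b w η h)^[k] f) x‖ ^ 2
      ≤ (q ^ 2) ^ k * (step b w η h)^[k] (fun x => Φ₂ (f x) * ‖fderiv ℝ f x‖ ^ 2) x := by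
  induction k generalizing x with
  | zero => simp
  | succ k ih =>
    rw [Function.iterate_succ_apply', Function.iterate_succ_apply', pow_succ' (q ^ 2) k,
      mul_assoc (q ^ 2)]
    set u := (step b w η h)^[k] f with hu
    have hureg : Reg u _ := hn.reg_iterate hb hh (hq.trans (pow_le_one₀ hq0 hq1)) hf k
    have huJ : ∀ x, u x ∈ J := hn.iterate_mem hΦ.convex hfJ k
    have h0 : 0 ≤ Φ₂ (step b w η h u x) := hΦ.nonneg _ (hn.avg_mem hΦ.convex huJ _)
    calc _ ≤ Φ₂ (step b w η h u x) * (q * step b w η h (fun x => ‖fderiv ℝ u x‖) x) ^ 2 := by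
          gcongr
          exact hn.norm_fderiv_step_le hb hh hq0 hq hureg x
      _ = q ^ 2 * (Φ₂ (step b w η h u x) * step b w η h (fun x => ‖fderiv ℝ u x‖) x ^ 2) := by ring
      _ ≤ q ^ 2 * step b w η h (fun x => Φ₂ (u x) * ‖fderiv ℝ u x‖ ^ 2) x := by
          gcongr
          exact hn.jensen hΦ huJ _
      _ ≤ _ := by
          gcongr
          refine (hn.avg_mono ih _).trans_eq ?_
          rw [avg_const_mul]; rfl

theorem Noise.entropy_iterate_le [CompleteSpace E] (hn : Noise e w η N) (hb : Drift b ρ L) (hh : 0 ≤ h)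
    (hh1 : 2 * h ≤ 1)
    {q : ℝ} (hq0 : 0 ≤ q) (hq1 : q ≤ 1) (hq : 1 - 2 * ρ * h + h ^ 2 * L ^ 2 ≤ q ^ 2)
    (hΦ : Admissible Φ Φ₁ Φ₂ J K) {τ δ : ℝ} (hτ : 0 < τ)
    (hT : ∀ p ∈ J, ∀ r ∈ J, |r - p| ≤ δ →
      Φ r ≤ Φ p + Φ₁ p * (r - p) + (1 / 2) * (Φ₂ p + τ) * (r - p) ^ 2)
    {f : E → ℝ} {M M' : ℝ} (hf : Reg f M) (hfJ : ∀ x, f x ∈ J)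
    (hδ : 2 * (M' * (Real.sqrt (2 * h) * N)) ≤ δ) (n : ℕ)
    (hM' : ∀ k < n, (1 + 4 * L * h) ^ k * M ≤ M') (x : E) :
    (step b w η h)^[n] (fun x => Φ (f x)) x ≤ Φ ((step b w η h)^[n] f x)
      + (h * ∑ i ∈ Finset.range n, (q ^ 2) ^ i)
        * (step b w η h)^[n] (fun x => Φ₂ (f x) * ‖fderiv ℝ f x‖ ^ 2) x
      + n * (2 * h * (τ * M' ^ 2 + 3 * (K + τ) * Real.sqrt (2 * h) * M' ^ 2 * N ^ 4)) := by
  set c := 2 * h * (τ * M' ^ 2 + 3 * (K + τ) * Real.sqrt (2 * h) * M' ^ 2 * N ^ 4) with hc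
  induction n generalizing x with
  | zero => simp
  | succ n ih =>
    have ih' := ih (fun k hk => hM' k (hk.trans n.lt_succ_self))
    rw [Function.iterate_succ_apply', Function.iterate_succ_apply', Function.iterate_succ_apply']
    set u := (step b w η h)^[n] f with hu
    set F := (step b w η h)^[n] (fun x => Φ₂ (f x) * ‖fderiv ℝ f x‖ ^ 2) with hF
    have hureg : Reg u M' := (hn.reg_iterate hb hh (hq.trans (pow_le_one₀ hq0 hq1)) hf n).mono
      (hM' n n.lt_succ_self)
    have huJ : ∀ x, u x ∈ J := hn.iterate_mem hΦ.convex hfJ n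
    have h1 := hn.avg_mono (s := Real.sqrt (2 * h)) ih' (x - h • b x)
    have h2 := hn.step_affine (b := b) (h := h) (fun x => Φ (u x)) F
      (h * ∑ i ∈ Finset.range n, (q ^ 2) ^ i) (n * c) x
    have hs2 : Real.sqrt (2 * h) ^ 2 = 2 * h := Real.sq_sqrt (by positivity)
    have h3 := hn.entropy_le hΦ hτ hT hureg huJ (Real.sqrt_nonneg (2 * h))
      (Real.sqrt_le_one.mpr hh1) hδ (x - h • b x)
    rw [hs2, ← hc] at h3
    have h4 : step b w η h (fun x => Φ₂ (u x) * ‖fderiv ℝ u x‖ ^ 2) x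
        ≤ (q ^ 2) ^ n * step b w η h F x := by
      refine (hn.avg_mono (hn.fisher_iterate_le hb hh hq0 hq1 hq hΦ hf hfJ n) _).trans_eq ?_
      rw [avg_const_mul]; rfl
    have h5 := mul_le_mul_of_nonneg_left h4 hh
    rw [Finset.sum_range_succ]
    simp only [step] at h1 h2 h3 h5 ⊢
    push_cast
    linarith

end entropy

section weak

/-- The generator of the diffusion with drift `-b`. -/
noncomputable def gen (e : OrthonormalBasis (Fin d) ℝ E) (b : E → E) (u : E → ℝ) (x : E) : ℝ :=
  ∑ i, fderiv ℝ (fderiv ℝ u) x (e i) (e i) - fderiv ℝ u x (b x)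

theorem Noise.abs_step_sub_le (hn : Noise e w η N) (hh : 0 ≤ h) (hh1 : 2 * h ≤ 1)
    {u : E → ℝ} {M : ℝ} (hu : Reg u M) (x : E) :
    |step b w η h u x - u x - h * gen e b u x|
      ≤ M * (h * Real.sqrt h) * (3 * N ^ 3 + d + (1 + d) * ‖b x‖ ^ 2) := by
  have hM := hu.nonneg
  have hN := hn.one_le
  set s := Real.sqrt (2 * h) with hs
  have hs0 : 0 ≤ s := Real.sqrt_nonneg _
  have hs2 : s ^ 2 = 2 * h := Real.sq_sqrt (by positivity)
  have hs3 : s ^ 3 ≤ 3 * (h * Real.sqrt h) := by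
    have h1 : s = Real.sqrt 2 * Real.sqrt h := Real.sqrt_mul (by norm_num) h
    have h2 : Real.sqrt 2 ≤ 3 / 2 := by
      rw [Real.sqrt_le_left (by norm_num)]; norm_num
    calc s ^ 3 = s ^ 2 * s := by ring
      _ = 2 * h * (Real.sqrt 2 * Real.sqrt h) := by rw [hs2, h1]
      _ ≤ 2 * h * (3 / 2 * Real.sqrt h) := by gcongr
      _ = _ := by ring
  have hhs : h ^ 2 ≤ h * Real.sqrt h := by
    rw [pow_two]; gcongr
    apply Real.le_sqrt_of_sq_le
    nlinarith
  set y := x - h • b x with hy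
  have hyx : y = x + (-(h • b x)) := by rw [hy, sub_eq_add_neg]
  have hnorm : ‖-(h • b x)‖ = h * ‖b x‖ := by
    rw [norm_neg, norm_smul, Real.norm_eq_abs, abs_of_nonneg hh]
  have t1 : |avg w η s u y - u y - h * ∑ i, fderiv ℝ (fderiv ℝ u) y (e i) (e i)|
      ≤ M * (3 * (h * Real.sqrt h)) * N ^ 3 := by
    have e1 : avg w η s u y - u y - h * ∑ i, fderiv ℝ (fderiv ℝ u) y (e i) (e i)
        = ∑ j, w j * (u (y + s • η j) - u y - fderiv ℝ u y (s • η j)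
          - (1 / 2) * fderiv ℝ (fderiv ℝ u) y (s • η j) (s • η j)) := by
      have e2 : ∑ j, w j * (u (y + s • η j) - u y - fderiv ℝ u y (s • η j)
          - (1 / 2) * fderiv ℝ (fderiv ℝ u) y (s • η j) (s • η j))
          = avg w η s u y - (∑ j, w j) * u y - s * ∑ j, w j * fderiv ℝ u y (η j)
            - (s ^ 2 / 2) * ∑ j, w j * fderiv ℝ (fderiv ℝ u) y (η j) (η j) := by
        simp only [avg, Finset.mul_sum, Finset.sum_mul, ← Finset.sum_sub_distrib]
        refine Finset.sum_congr rfl fun j _ => ?_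
        simp
        ring
      rw [e2, hn.sum_one, hn.mean, hn.cov, hs2]
      ring
    rw [e1]
    refine hn.norm_weighted_sum_le (F := ℝ) fun j => (hu.taylor_two y (s • η j)).trans ?_
    rw [norm_smul, Real.norm_eq_abs, abs_of_nonneg hs0, mul_pow, mul_assoc]
    gcongr
    exact hn.norm_le j
  have t2 : |u y - u x + h * fderiv ℝ u x (b x)| ≤ M * (h * Real.sqrt h) * ‖b x‖ ^ 2 := by
    have := hu.taylor_one x (-(h • b x))
    rw [← hyx, hnorm] at this
    simp only [map_neg, map_smul, smul_eq_mul, sub_neg_eq_add] at this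
    refine this.trans ?_
    rw [mul_pow, ← mul_assoc]
    gcongr
  have t3 : |∑ i, fderiv ℝ (fderiv ℝ u) y (e i) (e i) - ∑ i, fderiv ℝ (fderiv ℝ u) x (e i) (e i)|
      ≤ d * (M * (h * ‖b x‖)) := by
    rw [← Finset.sum_sub_distrib]
    refine (Finset.abs_sum_le_sum_abs _ _).trans ?_
    calc _ ≤ ∑ _i : Fin d, M * (h * ‖b x‖) := Finset.sum_le_sum fun i _ => by
          have h1 := (fderiv ℝ (fderiv ℝ u) y - fderiv ℝ (fderiv ℝ u) x).le_opNorm₂ (e i) (e i)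
          rw [e.norm_eq_one, mul_one, mul_one] at h1
          refine le_trans h1 ((hu.d3 y x).trans_eq ?_)
          rw [hyx, add_sub_cancel_left, hnorm]
      _ = _ := by simp
  have t3' : |h * (∑ i, fderiv ℝ (fderiv ℝ u) y (e i) (e i)
      - ∑ i, fderiv ℝ (fderiv ℝ u) x (e i) (e i))|
      ≤ d * (M * (h * Real.sqrt h) * (1 + ‖b x‖ ^ 2)) := by
    rw [abs_mul, abs_of_nonneg hh]
    calc _ ≤ h * (d * (M * (h * ‖b x‖))) := by gcongr
      _ = d * (M * h ^ 2 * ‖b x‖) := by ring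
      _ ≤ _ := by
        gcongr
        nlinarith [sq_nonneg (‖b x‖ - 1)]
  have e3 : step b w η h u x - u x - h * gen e b u x
      = (avg w η s u y - u y - h * ∑ i, fderiv ℝ (fderiv ℝ u) y (e i) (e i))
        + (u y - u x + h * fderiv ℝ u x (b x))
        + h * (∑ i, fderiv ℝ (fderiv ℝ u) y (e i) (e i)
          - ∑ i, fderiv ℝ (fderiv ℝ u) x (e i) (e i)) := by
    simp only [step, gen]
    rw [← hs, ← hy]
    ring
  rw [e3]
  refine (abs_add_three _ _ _).trans ((add_le_add (add_le_add t1 t2) t3').trans_eq ?_)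
  ring

end weak

end PhiSobolev

namespace PhiSobolev

open scoped ContDiff
open Filter Topology

variable {E : Type*} [NormedAddCommGroup E] [InnerProductSpace ℝ E]
variable {ι : Type*} [Fintype ι] {d : ℕ}
variable {e : OrthonormalBasis (Fin d) ℝ E} {w : ι → ℝ} {η : ι → E} {N : ℝ}
variable {b : E → E} {ρ L h : ℝ}

section invariant

variable [MeasurableSpace E] [BorelSpace E]

/-- A probability measure with finite second moment, invariant under the diffusion with
drift `-b`. -/
structure Invariant (e : OrthonormalBasis (Fin d) ℝ E) (b : E → E) (μ : Measure E) : Prop where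
  isProb : IsProbabilityMeasure μ
  sq_norm : Integrable (fun x => ‖x‖ ^ 2) μ
  integral_gen : ∀ (u : E → ℝ) (M : ℝ), Reg u M → ∫ x, gen e b u x ∂μ = 0

/-- Continuous functions which are uniform limits of regular functions. -/
def Approx (g : E → ℝ) : Prop :=
  Continuous g ∧ ∀ ε > 0, ∃ (ψ : E → ℝ) (M : ℝ), Reg ψ M ∧ ∀ x, |ψ x - g x| ≤ ε

variable {μ : Measure E}

omit [MeasurableSpace E] [BorelSpace E] in
theorem Reg.approx {u : E → ℝ} {M : ℝ} (hu : Reg u M) : Approx u :=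
  ⟨hu.contDiff.continuous, fun ε hε => ⟨u, M, hu, fun x => by simpa using hε.le⟩⟩

theorem Invariant.norm (hμ : Invariant e b μ) : Integrable (fun x : E => ‖x‖) μ := by
  have := hμ.isProb
  refine ((integrable_const 1).add hμ.sq_norm).mono' (by fun_prop) (Eventually.of_forall fun x => ?_)
  simp only [norm_norm, Pi.add_apply]
  nlinarith [sq_nonneg (‖x‖ - 1), norm_nonneg x]

theorem Invariant.integrable_reg (hμ : Invariant e b μ) {u : E → ℝ} {M : ℝ} (hu : Reg u M) :
    Integrable u μ := by
  have := hμ.isProb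
  refine ((integrable_const |u 0|).add (hμ.norm.const_mul M)).mono'
    hu.contDiff.continuous.aestronglyMeasurable (Eventually.of_forall fun x => ?_)
  have h1 := lipschitz_of_fderiv hu.contDiff hu.d1 x 0
  simp only [sub_zero, Pi.add_apply, Real.norm_eq_abs] at h1 ⊢
  linarith [abs_sub_abs_le_abs_sub (u x) (u 0)]

theorem Invariant.integrable_approx (hμ : Invariant e b μ) {g : E → ℝ} (hg : Approx g) :
    Integrable g μ := by
  have := hμ.isProb
  obtain ⟨ψ, M, hψ, hψg⟩ := hg.2 1 one_pos
  refine ((hμ.integrable_reg hψ).norm.add (integrable_const 1)).mono'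
    hg.1.aestronglyMeasurable (Eventually.of_forall fun x => ?_)
  simp only [Pi.add_apply, Real.norm_eq_abs]
  have h1 := hψg x
  have h2 := abs_sub_abs_le_abs_sub (g x) (ψ x)
  rw [abs_sub_comm] at h1
  linarith

theorem Invariant.integrable_drift (hμ : Invariant e b μ) (hb : Drift b ρ L) :
    Integrable (fun x => ‖b x‖ ^ 2) μ := by
  have := hμ.isProb
  have hL := hb.nonneg
  refine ((integrable_const (2 * ‖b 0‖ ^ 2)).add (hμ.sq_norm.const_mul (2 * L ^ 2))).mono'
    (hb.contDiff.continuous.norm.pow 2).aestronglyMeasurable (Eventually.of_forall fun x => ?_)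
  have h1 := lipschitz_of_fderiv hb.contDiff hb.d1 x 0
  have h2 : ‖b x‖ ≤ ‖b 0‖ + L * ‖x‖ := by
    have := norm_sub_norm_le (b x) (b 0)
    rw [sub_zero] at h1
    linarith
  simp only [norm_pow, norm_norm, Pi.add_apply]
  have h3 : ‖b x‖ ^ 2 ≤ (‖b 0‖ + L * ‖x‖) ^ 2 := by gcongr
  nlinarith [sq_nonneg (‖b 0‖ - L * ‖x‖)]

theorem Invariant.integrable_gen (hμ : Invariant e b μ) (hb : Drift b ρ L) {u : E → ℝ} {M : ℝ}
    (hu : Reg u M) : Integrable (gen e b u) μ := by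
  have := hμ.isProb
  have h1 := fderiv_contDiff hu.contDiff
  have h2 := fderiv_contDiff h1
  have hM := hu.nonneg
  have hcont : Continuous (gen e b u) := by
    have c1 := h1.continuous
    have c2 := h2.continuous
    have c3 := hb.contDiff.continuous
    unfold gen
    fun_prop
  refine ((integrable_const (d * M + M)).add ((hμ.integrable_drift hb).const_mul M)).mono'
    hcont.aestronglyMeasurable (Eventually.of_forall fun x => ?_)
  have e1 : |∑ i, fderiv ℝ (fderiv ℝ u) x (e i) (e i)| ≤ d * M := by
    refine (Finset.abs_sum_le_sum_abs _ _).trans ?_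
    calc _ ≤ ∑ _i : Fin d, M := Finset.sum_le_sum fun i _ => by
          have h1 := (fderiv ℝ (fderiv ℝ u) x).le_opNorm₂ (e i) (e i)
          rw [e.norm_eq_one, mul_one, mul_one] at h1
          exact le_trans h1 (hu.d2 x)
      _ = _ := by simp
  have e2 : |fderiv ℝ u x (b x)| ≤ M * ‖b x‖ :=
    ((fderiv ℝ u x).le_opNorm _).trans (by gcongr; exact hu.d1 x)
  have e3 : M * ‖b x‖ ≤ M * (1 + ‖b x‖ ^ 2) := by
    gcongr
    nlinarith [sq_nonneg (‖b x‖ - 1), norm_nonneg (b x)]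
  simp only [Pi.add_apply, Real.norm_eq_abs, gen]
  refine (abs_sub _ _).trans ?_
  linarith

theorem Invariant.abs_integral_step_sub_le (hμ : Invariant e b μ) (hb : Drift b ρ L)
    (hn : Noise e w η N) (hh : 0 ≤ h) (hh1 : 2 * h ≤ 1)
    (hq : 1 - 2 * ρ * h + h ^ 2 * L ^ 2 ≤ 1) {u : E → ℝ} {M : ℝ} (hu : Reg u M) :
    |∫ x, step b w η h u x ∂μ - ∫ x, u x ∂μ|
      ≤ M * (h * Real.sqrt h) * ∫ x, (3 * N ^ 3 + d + (1 + d) * ‖b x‖ ^ 2) ∂μ := by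
  have := hμ.isProb
  have i1 := hμ.integrable_reg (hn.reg_step hb hh hq hu)
  have i2 := hμ.integrable_reg hu
  have i3 := (hμ.integrable_gen hb hu).const_mul h
  have h0 : ∫ x, (step b w η h u x - u x - h * gen e b u x) ∂μ
      = ∫ x, step b w η h u x ∂μ - ∫ x, u x ∂μ := by
    rw [integral_sub (f := fun x => step b w η h u x - u x) (i1.sub i2) i3, integral_sub i1 i2,
      integral_const_mul,
      hμ.integral_gen u M hu]
    simp
  rw [← h0, ← integral_const_mul]
  refine norm_integral_le_of_norm_le (f := fun x => step b w η h u x - u x - h * gen e b u x)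
    (Integrable.const_mul ?_ _) (Eventually.of_forall fun x => hn.abs_step_sub_le hh hh1 hu x)
  exact (integrable_const _).add ((hμ.integrable_drift hb).const_mul _)

theorem Invariant.abs_integral_iterate_sub_le (hμ : Invariant e b μ) (hb : Drift b ρ L)
    (hn : Noise e w η N) (hh : 0 ≤ h) (hh1 : 2 * h ≤ 1)
    (hq : 1 - 2 * ρ * h + h ^ 2 * L ^ 2 ≤ 1) {u : E → ℝ} {M M' : ℝ} (hu : Reg u M) (n : ℕ)
    (hM' : ∀ k < n, (1 + 4 * L * h) ^ k * M ≤ M') :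
    |∫ x, (step b w η h)^[n] u x ∂μ - ∫ x, u x ∂μ|
      ≤ n * (M' * (h * Real.sqrt h) * ∫ x, (3 * N ^ 3 + d + (1 + d) * ‖b x‖ ^ 2) ∂μ) := by
  induction n with
  | zero => simp
  | succ n ih =>
    have h1 := hμ.abs_integral_step_sub_le hb hn hh hh1 hq
      ((hn.reg_iterate hb hh hq hu n).mono (hM' n n.lt_succ_self))
    have h2 := ih fun k hk => hM' k (hk.trans n.lt_succ_self)
    rw [Function.iterate_succ_apply']
    refine (abs_sub_le _ (∫ x, (step b w η h)^[n] u x ∂μ) _).trans ?_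
    push_cast
    linarith

theorem Invariant.abs_iterate_sub_integral_le (hμ : Invariant e b μ) (hb : Drift b ρ L)
    (hn : Noise e w η N) (hh : 0 ≤ h) (hh1 : 2 * h ≤ 1) {q : ℝ} (hq0 : 0 ≤ q) (hq1 : q ≤ 1)
    (hq : 1 - 2 * ρ * h + h ^ 2 * L ^ 2 ≤ q ^ 2) {u : E → ℝ} {M M' : ℝ} (hu : Reg u M) (n : ℕ)
    (hM' : ∀ k < n, (1 + 4 * L * h) ^ k * M ≤ M') :
    |(step b w η h)^[n] u 0 - ∫ x, u x ∂μ|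
      ≤ q ^ n * M * ∫ x, ‖x‖ ∂μ
        + n * (M' * (h * Real.sqrt h) * ∫ x, (3 * N ^ 3 + d + (1 + d) * ‖b x‖ ^ 2) ∂μ) := by
  have := hμ.isProb
  have hq' := hq.trans (pow_le_one₀ hq0 hq1)
  have hr := hn.reg_iterate hb hh hq' hu n
  have h1 := hμ.abs_integral_iterate_sub_le hb hn hh hh1 hq' hu n hM'
  have h2 : |(step b w η h)^[n] u 0 - ∫ x, (step b w η h)^[n] u x ∂μ|
      ≤ q ^ n * M * ∫ x, ‖x‖ ∂μ := by
    have e0 : (step b w η h)^[n] u 0 - ∫ x, (step b w η h)^[n] u x ∂μ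
        = ∫ x, ((step b w η h)^[n] u 0 - (step b w η h)^[n] u x) ∂μ := by
      rw [integral_sub (integrable_const _) (hμ.integrable_reg hr)]; simp
    rw [e0, ← integral_const_mul]
    refine norm_integral_le_of_norm_le
      (f := fun x => (step b w η h)^[n] u 0 - (step b w η h)^[n] u x) (hμ.norm.const_mul _)
      (Eventually.of_forall fun x => ?_)
    have := lipschitz_of_fderiv hr.contDiff (hn.norm_fderiv_iterate_le hb hh hq0 hq1 hq hu n) 0 x
    simpa using this
  exact (abs_sub_le _ _ _).trans (add_le_add h2 h1)

omit [MeasurableSpace E] [BorelSpace E] in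
/-- For small time steps the Euler scheme contracts at any rate `ρ' < ρ`. -/
theorem eventually_contraction {ρ' T : ℝ} (hρ' : 0 < ρ') (hρ : ρ' < ρ) (hT : 0 < T) :
    ∀ᶠ n : ℕ in atTop, 0 < n ∧ 2 * (T / n) ≤ 1 ∧ ∃ q : ℝ, 0 ≤ q ∧ q ≤ 1 ∧
      1 - 2 * ρ * (T / n) + (T / n) ^ 2 * L ^ 2 ≤ q ^ 2 ∧ q ^ n ≤ Real.exp (-(ρ' * T)) ∧
      (T / n) * ∑ i ∈ Finset.range n, (q ^ 2) ^ i ≤ 1 / (2 * ρ') := by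
  have ht : Tendsto (fun n : ℕ => T / n) atTop (𝓝 0) := tendsto_const_div_atTop_nhds_zero_nat T
  have h1 : ∀ᶠ n : ℕ in atTop, 2 * (T / n) ≤ 1 := by
    filter_upwards [ht.eventually_le_const (show (0 : ℝ) < 1 / 2 by norm_num)] with n hn
    linarith
  have h2 : ∀ᶠ n : ℕ in atTop, T / n * (2 * ρ') ≤ 1 := by
    have := ht.mul_const (2 * ρ')
    rw [zero_mul] at this
    exact this.eventually_le_const one_pos
  have h3 : ∀ᶠ n : ℕ in atTop, T / n * L ^ 2 ≤ 2 * (ρ - ρ') := by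
    have := ht.mul_const (L ^ 2)
    rw [zero_mul] at this
    exact this.eventually_le_const (by linarith)
  filter_upwards [h1, h2, h3, eventually_gt_atTop 0] with n h1 h2 h3 h4
  have hn : (0 : ℝ) < n := by exact_mod_cast h4
  have hnh : n * (T / n) = T := by field_simp
  set h := T / n with hh
  have hh0 : 0 < h := by positivity
  have hs : Real.sqrt (1 - 2 * ρ' * h) ^ 2 = 1 - 2 * ρ' * h := Real.sq_sqrt (by linarith)
  refine ⟨h4, h1, Real.sqrt (1 - 2 * ρ' * h), Real.sqrt_nonneg _, ?_, ?_, ?_, ?_⟩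
  · rw [Real.sqrt_le_one]
    have : 0 < ρ' * h := by positivity
    linarith
  · rw [hs]; nlinarith
  · have : Real.sqrt (1 - 2 * ρ' * h) ≤ Real.exp (-(ρ' * h)) := by
      rw [Real.sqrt_le_left (Real.exp_pos _).le, ← Real.exp_nat_mul]
      have := Real.add_one_le_exp (-(2 * ρ' * h))
      push_cast
      rw [show (2 : ℝ) * -(ρ' * h) = -(2 * ρ' * h) by ring]
      linarith
    calc _ ≤ Real.exp (-(ρ' * h)) ^ n := by gcongr
      _ = _ := by rw [← Real.exp_nat_mul, ← hnh]; ring_nf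
  · rw [hs]
    have hg := mul_neg_geom_sum (1 - 2 * ρ' * h) n
    have hp : 0 ≤ (1 - 2 * ρ' * h) ^ n := pow_nonneg (by linarith) n
    rw [le_div_iff₀ (by positivity)]
    nlinarith

theorem growth_le {T M : ℝ} (hL : 0 ≤ L) (hT : 0 ≤ T) (hM : 0 ≤ M) {n : ℕ} (hn : 0 < n) {k : ℕ}
    (hk : k < n) : (1 + 4 * L * (T / n)) ^ k * M ≤ Real.exp (4 * L * T) * M := by
  have hn' : (0 : ℝ) < n := by exact_mod_cast hn
  have hnh : n * (T / n) = T := by field_simp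
  gcongr
  have h1 : 1 ≤ 1 + 4 * L * (T / n) := by
    have : 0 ≤ 4 * L * (T / n) := by positivity
    linarith
  calc _ ≤ (1 + 4 * L * (T / n)) ^ n := pow_le_pow_right₀ h1 hk.le
    _ ≤ Real.exp (4 * L * (T / n)) ^ n := by
      gcongr
      linarith [Real.add_one_le_exp (4 * L * (T / n))]
    _ = _ := by
      rw [← Real.exp_nat_mul]
      congr 1
      rw [← mul_assoc, mul_comm (n : ℝ), mul_assoc, hnh]

/-- Ergodicity of the Euler scheme, uniformly for small time steps. -/
theorem Invariant.iterate_tendsto (hμ : Invariant e b μ) (hb : Drift b ρ L)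
    (hn : Noise e w η N) (hρ : 0 < ρ) {g : E → ℝ} (hg : Approx g) {ε : ℝ} (hε : 0 < ε) :
    ∀ᶠ T : ℝ in atTop, ∀ᶠ n : ℕ in atTop,
      |(step b w η (T / n))^[n] g 0 - ∫ x, g x ∂μ| ≤ ε := by
  have := hμ.isProb
  have hL := hb.nonneg
  obtain ⟨ψ, M, hψ, hψg⟩ := hg.2 (ε / 4) (by positivity)
  have hM := hψ.nonneg
  have h_int : |∫ x, ψ x ∂μ - ∫ x, g x ∂μ| ≤ ε / 4 := by
    rw [← integral_sub (hμ.integrable_reg hψ) (hμ.integrable_approx hg)]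
    refine (norm_integral_le_of_norm_le_const (f := fun x => ψ x - g x)
      (Eventually.of_forall hψg)).trans ?_
    simp
  have hdecay : ∀ᶠ T : ℝ in atTop, Real.exp (-(ρ / 2 * T)) * (M * ∫ x, ‖x‖ ∂μ) ≤ ε / 4 := by
    have h1 : Tendsto (fun T : ℝ => Real.exp (-(ρ / 2 * T)) * (M * ∫ x, ‖x‖ ∂μ)) atTop
        (𝓝 (0 * (M * ∫ x, ‖x‖ ∂μ))) :=
      (Real.tendsto_exp_neg_atTop_nhds_zero.comp
        (tendsto_id.const_mul_atTop (by positivity))).mul_const _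
    rw [zero_mul] at h1
    exact h1.eventually_le_const (by positivity)
  filter_upwards [hdecay, eventually_gt_atTop 0] with T hT hT0
  set C := ∫ x, (3 * N ^ 3 + d + (1 + d) * ‖b x‖ ^ 2) ∂μ with hC
  have herr : ∀ᶠ n : ℕ in atTop,
      T * (Real.exp (4 * L * T) * M * Real.sqrt (T / n) * C) ≤ ε / 4 := by
    have h1 : Tendsto (fun n : ℕ => T * (Real.exp (4 * L * T) * M * Real.sqrt (T / n) * C)) atTop
        (𝓝 (T * (Real.exp (4 * L * T) * M * Real.sqrt 0 * C))) :=
      ((((Real.continuous_sqrt.tendsto 0).comp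
        (tendsto_const_div_atTop_nhds_zero_nat T)).const_mul _).mul_const _).const_mul _
    simp only [Real.sqrt_zero, mul_zero, zero_mul] at h1
    exact h1.eventually_le_const (by positivity)
  filter_upwards [herr, eventually_contraction (L := L) (half_pos hρ) (half_lt_self hρ) hT0]
    with n h1 ⟨hn0, h2, q, hq0, hq1, hq, hqn, _⟩
  have hn' : (0 : ℝ) < n := by exact_mod_cast hn0
  have hnh : n * (T / n) = T := by field_simp
  have k1 := hμ.abs_iterate_sub_integral_le hb hn (by positivity) h2 hq0 hq1 hq hψ n
    fun k hk => growth_le hL hT0.le hM hn0 hk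
  rw [← hC] at k1
  have k2 := hn.abs_iterate_sub_le (b := b) (h := T / n) hψg n 0
  have k3 : q ^ n * M * ∫ x, ‖x‖ ∂μ ≤ ε / 4 := by
    refine le_trans ?_ hT
    rw [mul_assoc]
    have : 0 ≤ ∫ x, ‖x‖ ∂μ := integral_nonneg fun x => norm_nonneg x
    gcongr
  have k4 : n * (Real.exp (4 * L * T) * M * (T / n * Real.sqrt (T / n)) * C) ≤ ε / 4 := by
    refine le_of_eq_of_le ?_ h1
    calc _ = n * (T / n) * (Real.exp (4 * L * T) * M * Real.sqrt (T / n) * C) := by ring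
      _ = _ := by rw [hnh]
  rw [abs_le] at *
  constructor <;> linarith [k1.1, k1.2, k2.1, k2.2, h_int.1, h_int.2]

variable {Φ Φ₁ Φ₂ : ℝ → ℝ} {J : Set ℝ} {K : ℝ}

theorem Invariant.entropy_le_of_lt [CompleteSpace E] (hμ : Invariant e b μ) (hb : Drift b ρ L)
    (hn : Noise e w η N) {ρ' : ℝ} (hρ' : 0 < ρ') (hρ : ρ' < ρ) (hΦ : Admissible Φ Φ₁ Φ₂ J K)
    (hJ : IsClosed J) (hΦc : ContinuousOn Φ J) {f : E → ℝ} {M : ℝ} (hf : Reg f M)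
    (hfJ : ∀ x, f x ∈ J) (hΦf : Approx fun x => Φ (f x))
    (hF : Approx fun x => Φ₂ (f x) * ‖fderiv ℝ f x‖ ^ 2) :
    ∫ x, Φ (f x) ∂μ - Φ (∫ x, f x ∂μ)
      ≤ 1 / (2 * ρ') * ∫ x, Φ₂ (f x) * ‖fderiv ℝ f x‖ ^ 2 ∂μ := by
  have := hμ.isProb
  have hL := hb.nonneg
  have hM := hf.nonneg
  have hN := hn.one_le
  have hmem : ∫ x, f x ∂μ ∈ J :=
    hΦ.convex.integral_mem hJ (Eventually.of_forall hfJ) (hμ.integrable_reg hf)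
  have hcoef : 0 < 1 / (2 * ρ') := by positivity
  refine le_of_forall_pos_le_add fun ε hε => ?_
  obtain ⟨κ, hκ, hκc⟩ := Metric.continuousWithinAt_iff.mp (hΦc _ hmem) (ε / 5) (by positivity)
  obtain ⟨T, ⟨⟨hT1, hT2⟩, hT3⟩, hT0⟩ := (((hμ.iterate_tendsto hb hn (hρ'.trans hρ) hf.approx
    (half_pos hκ)).and (hμ.iterate_tendsto hb hn (hρ'.trans hρ) hΦf (show 0 < ε / 5 by positivity))
    |>.and (hμ.iterate_tendsto hb hn (hρ'.trans hρ) hF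
      (show 0 < 2 * ρ' * (ε / 5) by positivity))).and (eventually_gt_atTop 0)).exists
  set M' := Real.exp (4 * L * T) * M with hM'
  have hM'0 : 0 ≤ M' := by positivity
  obtain ⟨τ, hτ, hτε⟩ : ∃ τ > 0, 2 * T * M' ^ 2 * τ ≤ ε / 5 := by
    refine ⟨ε / 5 / (2 * T * M' ^ 2 + 1), by positivity, ?_⟩
    rw [mul_div_assoc', div_le_iff₀ (by positivity)]
    nlinarith [show 0 ≤ 2 * T * M' ^ 2 by positivity]
  obtain ⟨δ, hδ, hδT⟩ := hΦ.taylor τ hτ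
  have hsq : Tendsto (fun n : ℕ => Real.sqrt (2 * (T / n))) atTop (𝓝 0) := by
    have := (Real.continuous_sqrt.tendsto (2 * 0)).comp
      ((tendsto_const_div_atTop_nhds_zero_nat T).const_mul 2)
    rw [mul_zero, Real.sqrt_zero] at this
    exact this
  have hs1 : ∀ᶠ n : ℕ in atTop, 2 * (M' * (Real.sqrt (2 * (T / n)) * N)) ≤ δ := by
    have := ((hsq.mul_const N).const_mul M').const_mul 2
    simp only [zero_mul, mul_zero] at this
    exact this.eventually_le_const hδ
  have hs2 : ∀ᶠ n : ℕ in atTop,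
      2 * T * (3 * (K + τ) * Real.sqrt (2 * (T / n)) * M' ^ 2 * N ^ 4) ≤ ε / 5 := by
    have := (((hsq.const_mul (3 * (K + τ))).mul_const (M' ^ 2)).mul_const (N ^ 4)).const_mul
      (2 * T)
    simp only [zero_mul, mul_zero] at this
    exact this.eventually_le_const (by positivity)
  obtain ⟨n, h1, h2, h3, h4, h5, hn0, hh1, q, hq0, hq1, hq, -, hsum⟩ :=
    (hT1.and (hT2.and (hT3.and (hs1.and (hs2.and
      (eventually_contraction (L := L) hρ' hρ hT0)))))).exists
  have hn' : (0 : ℝ) < n := by exact_mod_cast hn0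
  have hnh : n * (T / n) = T := by field_simp
  have key := hn.entropy_iterate_le hb (by positivity) hh1 hq0 hq1 hq hΦ hτ hδT hf hfJ h4 n
    (fun k hk => growth_le hL hT0.le hM hn0 hk) 0
  set S := (step b w η (T / n))^[n] (fun x => Φ₂ (f x) * ‖fderiv ℝ f x‖ ^ 2) 0 with hS
  have hS0 : 0 ≤ S := by
    have := hn.iterate_mem (b := b) (h := T / n) (convex_Ici 0)
      (g := fun x => Φ₂ (f x) * ‖fderiv ℝ f x‖ ^ 2)
      (fun x => mul_nonneg (hΦ.nonneg _ (hfJ x)) (sq_nonneg _)) n 0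
    exact this
  have k1 : Φ ((step b w η (T / n))^[n] f 0) ≤ Φ (∫ x, f x ∂μ) + ε / 5 := by
    have := hκc (hn.iterate_mem (b := b) (h := T / n) hΦ.convex hfJ n 0)
      (by rw [Real.dist_eq]; linarith)
    rw [Real.dist_eq] at this
    linarith [(abs_lt.mp this).2]
  have k2 : (T / n * ∑ i ∈ Finset.range n, (q ^ 2) ^ i) * S
      ≤ 1 / (2 * ρ') * ∫ x, Φ₂ (f x) * ‖fderiv ℝ f x‖ ^ 2 ∂μ + ε / 5 := by
    calc _ ≤ 1 / (2 * ρ') * S := by gcongr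
      _ ≤ 1 / (2 * ρ') * (∫ x, Φ₂ (f x) * ‖fderiv ℝ f x‖ ^ 2 ∂μ + 2 * ρ' * (ε / 5)) := by
        gcongr
        linarith [(abs_le.mp h3).2]
      _ = _ := by field_simp
  have k3 : n * (2 * (T / n) * (τ * M' ^ 2
      + 3 * (K + τ) * Real.sqrt (2 * (T / n)) * M' ^ 2 * N ^ 4)) ≤ ε / 5 + ε / 5 := by
    refine le_of_eq_of_le ?_ (add_le_add hτε h5)
    calc _ = n * (T / n) * (2 * (τ * M' ^ 2
          + 3 * (K + τ) * Real.sqrt (2 * (T / n)) * M' ^ 2 * N ^ 4)) := by ring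
      _ = _ := by rw [hnh]; ring
  rw [abs_le] at h2
  linarith [h2.1]

/-- The Φ-Sobolev inequality for an invariant measure of a uniformly contracting diffusion. -/
theorem Invariant.entropy_le [CompleteSpace E] (hμ : Invariant e b μ) (hb : Drift b ρ L)
    (hn : Noise e w η N) (hρ : 0 < ρ) (hΦ : Admissible Φ Φ₁ Φ₂ J K)
    (hJ : IsClosed J) (hΦc : ContinuousOn Φ J) {f : E → ℝ} {M : ℝ} (hf : Reg f M)
    (hfJ : ∀ x, f x ∈ J) (hΦf : Approx fun x => Φ (f x))
    (hF : Approx fun x => Φ₂ (f x) * ‖fderiv ℝ f x‖ ^ 2) :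
    ∫ x, Φ (f x) ∂μ - Φ (∫ x, f x ∂μ)
      ≤ 1 / (2 * ρ) * ∫ x, Φ₂ (f x) * ‖fderiv ℝ f x‖ ^ 2 ∂μ := by
  have hcont : ContinuousAt
      (fun r : ℝ => 1 / (2 * r) * ∫ x, Φ₂ (f x) * ‖fderiv ℝ f x‖ ^ 2 ∂μ) ρ := by
    have : 2 * ρ ≠ 0 := by positivity
    fun_prop (disch := assumption)
  refine ge_of_tendsto (hcont.tendsto.mono_left (nhdsWithin_le_nhds (s := Set.Iio ρ))) ?_
  filter_upwards [Ioo_mem_nhdsLT hρ] with r hr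
  exact hμ.entropy_le_of_lt hb hn hr.1 hr.2 hΦ hJ hΦc hf hfJ hΦf hF

end invariant

end PhiSobolev

namespace PhiSobolev

open scoped ContDiff
open Filter Topology

section gibbs

variable {d : ℕ} {V : EuclideanSpace ℝ (Fin d) → ℝ}

/-- The measure with density `exp (-V)`. -/
noncomputable def gibbs (V : EuclideanSpace ℝ (Fin d) → ℝ) : Measure (EuclideanSpace ℝ (Fin d)) :=
  volume.withDensity fun x => ENNReal.ofReal (Real.exp (-V x))

theorem integral_gibbs (hV : Continuous V) (g : EuclideanSpace ℝ (Fin d) → ℝ) :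
    ∫ x, g x ∂gibbs V = ∫ x, Real.exp (-V x) * g x := by
  rw [gibbs, integral_withDensity_eq_integral_toReal_smul (by fun_prop) (by simp)]
  refine integral_congr_ae (Eventually.of_forall fun x => ?_)
  simp [ENNReal.toReal_ofReal (Real.exp_pos _).le]

theorem integrable_gibbs (hV : Continuous V) {g : EuclideanSpace ℝ (Fin d) → ℝ} :
    Integrable g (gibbs V) ↔ Integrable fun x => Real.exp (-V x) * g x := by
  have hm := hV.measurable
  rw [gibbs, integrable_withDensity_iff_integrable_smul' (by fun_prop) (by simp)]
  refine integrable_congr (Eventually.of_forall fun x => ?_)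
  simp [ENNReal.toReal_ofReal (Real.exp_pos _).le]

theorem isProbabilityMeasure_gibbs (h : ∫ x, Real.exp (-V x) = 1) :
    IsProbabilityMeasure (gibbs V) := by
  refine ⟨?_⟩
  have hi : Integrable fun x => Real.exp (-V x) := by
    by_contra hc
    rw [integral_undef hc] at h
    exact zero_ne_one h
  rw [gibbs, withDensity_apply _ MeasurableSet.univ, Measure.restrict_univ,
    ← ofReal_integral_eq_lintegral_ofReal hi (Eventually.of_forall fun x => (Real.exp_pos _).le),
    h, ENNReal.ofReal_one]

theorem integrable_exp_quadratic {b : ℝ} (hb : 0 < b) (v : EuclideanSpace ℝ (Fin d)) :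
    Integrable fun x : EuclideanSpace ℝ (Fin d) => Real.exp (-b * ‖x‖ ^ 2 + inner ℝ v x) := by
  have := (GaussianFourier.integrable_cexp_neg_mul_sq_norm_add (b := (b : ℂ)) (by simpa) 1 v).norm
  refine this.congr (Eventually.of_forall fun x => ?_)
  simp only [Complex.norm_exp]
  congr 1
  rw [show (-(b : ℂ) * (‖x‖ : ℂ) ^ 2 + 1 * ((inner ℝ v x : ℝ) : ℂ))
    = ((-b * ‖x‖ ^ 2 + inner ℝ v x : ℝ) : ℂ) by push_cast; ring, Complex.ofReal_re]

/-- Functions of at most quadratic growth are integrable against a density with Gaussian tails. -/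
theorem integrable_exp_neg_mul {α C D : ℝ} (hα : 0 < α) (hVc : Continuous V)
    (hV : ∀ x, α / 2 * ‖x‖ ^ 2 - C ≤ V x) {g : EuclideanSpace ℝ (Fin d) → ℝ} (hgc : Continuous g)
    (hg : ∀ x, |g x| ≤ D * (1 + ‖x‖ ^ 2)) : Integrable fun x => Real.exp (-V x) * g x := by
  have hD : 0 ≤ D := by simpa using (abs_nonneg _).trans (hg 0)
  refine ((integrable_exp_quadratic (b := α / 4) (by positivity) 0).const_mul
    (D * (1 + 4 / α) * Real.exp C)).mono' (by fun_prop) (Eventually.of_forall fun x => ?_)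
  rw [norm_mul, Real.norm_eq_abs, Real.norm_eq_abs, abs_of_pos (Real.exp_pos _), inner_zero_left,
    add_zero]
  have h1 : 1 + ‖x‖ ^ 2 ≤ (1 + 4 / α) * Real.exp (α / 4 * ‖x‖ ^ 2) := by
    have h2 := Real.add_one_le_exp (α / 4 * ‖x‖ ^ 2)
    calc 1 + ‖x‖ ^ 2 ≤ 1 + ‖x‖ ^ 2 + (4 / α + α / 4 * ‖x‖ ^ 2) := by
          have : 0 ≤ 4 / α + α / 4 * ‖x‖ ^ 2 := by positivity
          linarith
      _ = (1 + 4 / α) * (α / 4 * ‖x‖ ^ 2 + 1) := by field_simp; ring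
      _ ≤ _ := by gcongr
  calc Real.exp (-V x) * |g x|
      ≤ Real.exp (-(α / 2 * ‖x‖ ^ 2 - C)) * (D * ((1 + 4 / α) * Real.exp (α / 4 * ‖x‖ ^ 2))) := by
        gcongr
        · exact hV x
        · exact (hg x).trans (by gcongr)
    _ = D * (1 + 4 / α) * Real.exp C * Real.exp (-(α / 4) * ‖x‖ ^ 2) := by
        rw [show -(α / 2 * ‖x‖ ^ 2 - C) = C + (-(α / 4) * ‖x‖ ^ 2 + -(α / 4 * ‖x‖ ^ 2)) by ring,
          Real.exp_add, Real.exp_add, Real.exp_neg (α / 4 * ‖x‖ ^ 2)]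
        field_simp

end gibbs

section smooth

variable {E : Type*} [NormedAddCommGroup E] [InnerProductSpace ℝ E]

theorem exists_bounds {F : Type*} [NormedAddCommGroup F] [NormedSpace ℝ F] {u : E → F}
    (hu : ContDiff ℝ ∞ u) (hc : HasCompactSupport u) :
    ∃ M, 0 ≤ M ∧ (∀ x, ‖fderiv ℝ u x‖ ≤ M) ∧ (∀ x, ‖fderiv ℝ (fderiv ℝ u) x‖ ≤ M) ∧
      ∀ x y, ‖fderiv ℝ (fderiv ℝ u) x - fderiv ℝ (fderiv ℝ u) y‖ ≤ M * ‖x - y‖ := by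
  have h1 := fderiv_contDiff hu
  have h2 := fderiv_contDiff h1
  have h3 := fderiv_contDiff h2
  have c1 := hc.fderiv ℝ
  have c2 := c1.fderiv ℝ
  have c3 := c2.fderiv ℝ
  obtain ⟨M₁, hM₁⟩ := h1.continuous.bounded_above_of_compact_support c1
  obtain ⟨M₂, hM₂⟩ := h2.continuous.bounded_above_of_compact_support c2
  obtain ⟨M₃, hM₃⟩ := h3.continuous.bounded_above_of_compact_support c3
  have p1 := (norm_nonneg _).trans (hM₁ 0)
  have p2 := (norm_nonneg _).trans (hM₂ 0)
  have p3 := (norm_nonneg _).trans (hM₃ 0)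
  refine ⟨M₁ + M₂ + M₃, by positivity, fun x => (hM₁ x).trans (by linarith),
    fun x => (hM₂ x).trans (by linarith), fun x y => ?_⟩
  refine (lipschitz_of_fderiv h2 hM₃ x y).trans ?_
  gcongr
  linarith

theorem exists_reg {u : E → ℝ} {c : ℝ} (hu : ContDiff ℝ ∞ u)
    (hc : HasCompactSupport fun x => u x - c) : ∃ M, Reg u M := by
  obtain ⟨M, -, h1, h2, h3⟩ := exists_bounds (hu.sub contDiff_const) hc
  have e1 : fderiv ℝ (fun x => u x - c) = fderiv ℝ u := by
    ext1 x; exact fderiv_sub_const c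
  rw [e1] at h1 h2 h3
  exact ⟨M, hu, h1, h2, h3⟩

omit [InnerProductSpace ℝ E] in
theorem hasCompactSupport_comp_sub {u : E → ℝ} {c : ℝ} (hc : HasCompactSupport fun x => u x - c)
    (g : ℝ → ℝ) : HasCompactSupport fun x => g (u x) - g c := by
  have := hc.comp_left (g := fun t => g (t + c) - g c) (by simp)
  simpa [Function.comp_def] using this

variable {d : ℕ}

theorem contDiff_norm_fderiv_sq [CompleteSpace E] (e : OrthonormalBasis (Fin d) ℝ E) {u : E → ℝ}
    (hu : ContDiff ℝ ∞ u) : ContDiff ℝ ∞ fun x => ‖fderiv ℝ u x‖ ^ 2 := by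
  have h1 := fderiv_contDiff hu
  simp_rw [← sum_sq_eq_norm_sq e]
  exact ContDiff.sum fun i _ => (h1.clm_apply contDiff_const).pow 2

theorem contDiff_polynomial_eval (p : Polynomial ℝ) : ContDiff ℝ ∞ fun t : ℝ => p.eval t := by
  simpa [Polynomial.aeval_def] using p.contDiff_aeval (𝕜 := ℝ) (R := ℝ) ∞

theorem approx_comp {u : E → ℝ} {c : ℝ} (hu : ContDiff ℝ ∞ u)
    (hc : HasCompactSupport fun x => u x - c) {α β : ℝ} (huJ : ∀ x, u x ∈ Set.Icc α β)
    {G : ℝ → ℝ} (hG : ContinuousOn G (Set.Icc α β)) : Approx fun x => G (u x) := by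
  have hcont : Continuous (G ∘ u) := hG.comp_continuous hu.continuous huJ
  refine ⟨hcont, fun ε hε => ?_⟩
  obtain ⟨p, hp⟩ := exists_polynomial_near_of_continuousOn α β G hG ε hε
  obtain ⟨M, hM⟩ := exists_reg (u := fun x => p.eval (u x)) (c := p.eval c)
    ((contDiff_polynomial_eval p).comp hu) (hasCompactSupport_comp_sub hc fun t => p.eval t)
  exact ⟨fun x => p.eval (u x), M, hM, fun x => (hp _ (huJ x)).le⟩

theorem approx_comp_mul [CompleteSpace E] (e : OrthonormalBasis (Fin d) ℝ E) {u : E → ℝ} {c : ℝ}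
    (hu : ContDiff ℝ ∞ u) (hc : HasCompactSupport fun x => u x - c) {α β : ℝ}
    (huJ : ∀ x, u x ∈ Set.Icc α β) {G : ℝ → ℝ} (hG : ContinuousOn G (Set.Icc α β)) :
    Approx fun x => G (u x) * ‖fderiv ℝ u x‖ ^ 2 := by
  have hn := contDiff_norm_fderiv_sq e hu
  refine ⟨(hG.comp_continuous hu.continuous huJ).mul hn.continuous, fun ε hε => ?_⟩
  obtain ⟨M₀, hM₀⟩ := exists_reg hu hc
  have hM₀0 := hM₀.nonneg
  obtain ⟨p, hp⟩ := exists_polynomial_near_of_continuousOn α β G hG (ε / (M₀ ^ 2 + 1))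
    (by positivity)
  have hcs : HasCompactSupport fun x => p.eval (u x) * ‖fderiv ℝ u x‖ ^ 2 := by
    have h1 := hc.fderiv ℝ
    have e1 : fderiv ℝ (fun x => u x - c) = fderiv ℝ u := by
      ext1 x; exact fderiv_sub_const c
    rw [e1] at h1
    exact (h1.comp_left (g := fun l => ‖l‖ ^ 2) (by simp)).mul_left (f := fun x => p.eval (u x))
  obtain ⟨M, hM⟩ := exists_reg (u := fun x => p.eval (u x) * ‖fderiv ℝ u x‖ ^ 2) (c := 0)
    (((contDiff_polynomial_eval p).comp hu).mul hn) (by simpa using hcs)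
  refine ⟨_, M, hM, fun x => ?_⟩
  rw [← sub_mul, abs_mul, abs_of_nonneg (sq_nonneg ‖fderiv ℝ u x‖)]
  calc _ ≤ ε / (M₀ ^ 2 + 1) * M₀ ^ 2 := by
        gcongr
        · exact (hp _ (huJ x)).le
        · exact hM₀.d1 x
    _ ≤ ε := by
        rw [div_mul_eq_mul_div, div_le_iff₀ (by positivity)]
        nlinarith

end smooth

theorem admissible_Icc {Φ Φ₁ Φ₂ : ℝ → ℝ} {α β : ℝ}
    (h1 : ∀ p ∈ Set.Icc α β, HasDerivAt Φ (Φ₁ p) p) (h2 : ∀ p ∈ Set.Icc α β, HasDerivAt Φ₁ (Φ₂ p) p)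
    (hc : ContinuousOn Φ₂ (Set.Icc α β)) (h0 : ∀ p ∈ Set.Icc α β, 0 ≤ Φ₂ p)
    (hconv : ConvexOn ℝ (Set.Icc α β ×ˢ (Set.univ : Set ℝ))
      (fun p : ℝ × ℝ => Φ₂ p.1 * p.2 ^ 2)) :
    ∃ K, Admissible Φ Φ₁ Φ₂ (Set.Icc α β) K := by
  obtain ⟨K, hK⟩ := (isCompact_Icc.image_of_continuousOn hc).bddAbove
  refine ⟨K, convex_Icc α β, h0, fun p hp => hK ⟨p, hp, rfl⟩, hconv, fun τ hτ => ?_⟩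
  obtain ⟨δ, hδ, hu⟩ := Metric.uniformContinuousOn_iff_le.mp
    (isCompact_Icc.uniformContinuousOn_of_continuous hc) (τ / 2) (by positivity)
  refine ⟨δ, hδ, fun p hp r hr hpr => ?_⟩
  have hsub : segment ℝ p r ⊆ Set.Icc α β := (convex_Icc α β).segment_subset hp hr
  have hnear : ∀ t ∈ segment ℝ p r, |t - p| ≤ |r - p| := by
    intro t ht
    rw [segment_eq_image'] at ht
    obtain ⟨s, hs, rfl⟩ := ht
    simp only [add_sub_cancel_left, smul_eq_mul, abs_mul, abs_of_nonneg hs.1]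
    exact mul_le_of_le_one_left (abs_nonneg _) hs.2
  have k1 : ∀ t ∈ segment ℝ p r, |Φ₁ t - Φ₁ p - Φ₂ p * (t - p)| ≤ τ / 2 * |t - p| := by
    intro t ht
    have := Convex.norm_image_sub_le_of_norm_hasDerivWithin_le (𝕜 := ℝ)
      (f := fun t => Φ₁ t - Φ₂ p * t)
      (f' := fun t => Φ₂ t - Φ₂ p) (s := segment ℝ p r) (C := τ / 2) (x := p) (y := t) ?_ ?_
      (convex_segment _ _) (left_mem_segment _ _ _) ht
    · simp only [Real.norm_eq_abs] at this
      convert this using 2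
      ring
    · intro z hz
      have := ((h2 z (hsub hz)).sub ((hasDerivAt_id z).const_mul (Φ₂ p))).hasDerivWithinAt
        (s := segment ℝ p r)
      rwa [mul_one] at this
    · intro z hz
      have := hu z (hsub hz) p hp (by rw [Real.dist_eq]; exact (hnear z hz).trans hpr)
      rwa [Real.dist_eq] at this
  have k2 := Convex.norm_image_sub_le_of_norm_hasDerivWithin_le (𝕜 := ℝ)
      (f := fun t => Φ t - Φ₁ p * t - Φ₂ p / 2 * (t - p) ^ 2)
      (f' := fun t => Φ₁ t - Φ₁ p - Φ₂ p * (t - p)) (s := segment ℝ p r) (C := τ / 2 * |r - p|)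
      (x := p) (y := r) ?_ ?_ (convex_segment _ _) (left_mem_segment _ _ _)
      (right_mem_segment _ _ _)
  · simp only [Real.norm_eq_abs] at k2
    rw [mul_assoc, abs_mul_abs_self] at k2
    have := (abs_le.mp k2).2
    linarith
  · intro z hz
    have := (((h1 z (hsub hz)).sub ((hasDerivAt_id z).const_mul (Φ₁ p))).sub
      ((((hasDerivAt_id z).sub_const p).pow 2).const_mul (Φ₂ p / 2))).hasDerivWithinAt
      (s := segment ℝ p r)
    refine this.congr_deriv ?_
    simp
    ring
  · intro z hz
    exact (k1 z hz).trans (mul_le_mul_of_nonneg_left (hnear z hz) (by positivity))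

end PhiSobolev

namespace PhiSobolev

open scoped ContDiff
open Filter Topology

theorem exists_noise {E : Type*} [NormedAddCommGroup E] [InnerProductSpace ℝ E] {d : ℕ}
    (hd : 0 < d) (e : OrthonormalBasis (Fin d) ℝ E) :
    Noise e (fun _ : Fin d × Bool => 1 / (2 * (d : ℝ)))
      (fun j => (if j.2 then Real.sqrt d else -Real.sqrt d) • e j.1) (Real.sqrt d) := by
  have hd' : (0 : ℝ) < d := by exact_mod_cast hd
  refine ⟨fun j => by positivity, ?_, fun l => ?_, fun B => ?_, fun j => ?_, ?_⟩
  · simp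
    field_simp
  · simp [Fintype.sum_prod_type]
  · rw [Fintype.sum_prod_type]
    refine Finset.sum_congr rfl fun i _ => ?_
    simp only [Fintype.sum_bool, if_true, Bool.false_eq_true, if_false, map_smul,
      _root_.smul_apply, smul_eq_mul]
    have := Real.mul_self_sqrt hd'.le
    calc _ = 1 / (2 * (d : ℝ)) * (2 * (Real.sqrt d * Real.sqrt d) * B (e i) (e i)) := by ring
      _ = _ := by rw [this]; field_simp
  · rw [norm_smul, e.norm_eq_one, mul_one, Real.norm_eq_abs]
    split_ifs <;> simp [abs_of_nonneg (Real.sqrt_nonneg _)]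
  · rw [Real.one_le_sqrt]
    exact_mod_cast hd

section riesz

variable {E : Type*} [NormedAddCommGroup E] [InnerProductSpace ℝ E] {d : ℕ}

/-- The vector representing a linear form, as a continuous linear map. -/
noncomputable def riesz (e : OrthonormalBasis (Fin d) ℝ E) : (E →L[ℝ] ℝ) →L[ℝ] E :=
  ∑ i, (ContinuousLinearMap.apply ℝ ℝ (e i)).smulRight (e i)

theorem riesz_apply (e : OrthonormalBasis (Fin d) ℝ E) (l : E →L[ℝ] ℝ) :
    riesz e l = ∑ i, l (e i) • e i := by
  simp [riesz]

theorem inner_riesz (e : OrthonormalBasis (Fin d) ℝ E) (l : E →L[ℝ] ℝ) (y : E) :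
    inner ℝ (riesz e l) y = l y := by
  conv_rhs => rw [← e.sum_repr' y]
  simp only [riesz_apply, sum_inner, inner_smul_left, map_sum, map_smul, smul_eq_mul]
  exact Finset.sum_congr rfl fun i _ => by simp [mul_comm]

theorem riesz_innerSL (e : OrthonormalBasis (Fin d) ℝ E) (x : E) :
    riesz e (innerSL ℝ x) = x :=
  ext_inner_right ℝ fun y => by rw [inner_riesz, innerSL_apply_apply]

/-- Smooth functions equal to `α ‖x‖² / 2` up to a constant, outside a compact set. -/
structure Confining (V : E → ℝ) (α : ℝ) (ζ : E → ℝ) (β : ℝ) : Prop where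
  eq : ∀ x, V x = α / 2 * ‖x‖ ^ 2 + β + ζ x
  pos : 0 < α
  contDiff : ContDiff ℝ ∞ ζ
  compact : HasCompactSupport ζ

variable {V ζ : E → ℝ} {α β : ℝ}

theorem Confining.contDiff_pot (hV : Confining V α ζ β) : ContDiff ℝ ∞ V := by
  rw [funext hV.eq]
  exact ((contDiff_const.mul (contDiff_norm_sq ℝ)).add contDiff_const).add hV.contDiff

theorem Confining.fderiv_eq (hV : Confining V α ζ β) (x : E) :
    fderiv ℝ V x = α • innerSL ℝ x + fderiv ℝ ζ x := by
  rw [funext hV.eq]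
  have h1 := ((hasStrictFDerivAt_norm_sq x).hasFDerivAt.const_mul (α / 2)).add_const β
  have h2 := (hV.contDiff.differentiable (by simp)).differentiableAt (x := x).hasFDerivAt
  refine (h1.add h2).fderiv.trans ?_
  ext y
  simp
  ring

theorem Confining.exists_lower (hV : Confining V α ζ β) :
    ∃ C, ∀ x, α / 2 * ‖x‖ ^ 2 - C ≤ V x := by
  obtain ⟨M, hM⟩ := hV.contDiff.continuous.bounded_above_of_compact_support hV.compact
  refine ⟨M - β, fun x => ?_⟩
  rw [hV.eq]
  have := (abs_le.mp (hM x)).1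
  linarith

theorem Confining.exists_drift (hV : Confining V α ζ β) (e : OrthonormalBasis (Fin d) ℝ E) {ρ : ℝ}
    (hess : ∀ x y, ρ * ‖y‖ ^ 2 ≤ fderiv ℝ (fderiv ℝ V) x y y) :
    ∃ L, Drift (fun x => riesz e (fderiv ℝ V x)) ρ L := by
  have h1 := fderiv_contDiff hV.contDiff_pot
  have hα := hV.pos
  set G : E → E := fun x => riesz e (fderiv ℝ ζ x) with hG
  have hGc : ContDiff ℝ ∞ G := (riesz e).contDiff.comp (fderiv_contDiff hV.contDiff)
  have hGs : HasCompactSupport G := (hV.compact.fderiv ℝ).comp_left (g := riesz e) (map_zero _)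
  have hb : (fun x => riesz e (fderiv ℝ V x)) = fun x => α • x + G x := by
    ext1 x
    rw [hV.fderiv_eq, map_add, map_smul, riesz_innerSL]
  have hd1 : fderiv ℝ (fun x => α • x + G x)
      = fun x => fderiv ℝ G x + α • ContinuousLinearMap.id ℝ E := by
    ext1 x
    rw [add_comm]
    exact (((hasFDerivAt_id x).const_smul α).add
      ((hGc.differentiable (by simp)).differentiableAt).hasFDerivAt).fderiv
  obtain ⟨M, hM0, b1, b2, b3⟩ := exists_bounds hGc hGs
  have hd2 : fderiv ℝ (fderiv ℝ (fun x => α • x + G x)) = fderiv ℝ (fderiv ℝ G) := by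
    rw [hd1]
    ext1 x
    exact fderiv_add_const _
  refine ⟨M + α, (riesz e).contDiff.comp h1, fun x => ?_, fun x => ?_, fun x y => ?_,
    fun x y => ?_⟩
  · rw [hb, hd1]
    refine (norm_add_le _ _).trans (add_le_add (b1 x) ?_)
    rw [norm_smul, Real.norm_eq_abs, abs_of_pos hα]
    exact mul_le_of_le_one_right hα.le ContinuousLinearMap.norm_id_le
  · rw [hb, hd2]
    exact (b2 x).trans (by linarith)
  · rw [hb, hd2]
    refine (b3 x y).trans ?_
    gcongr
    linarith
  · have : fderiv ℝ (fun x => riesz e (fderiv ℝ V x)) x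
        = (riesz e).comp (fderiv ℝ (fderiv ℝ V) x) :=
      ((riesz e).hasFDerivAt.comp x
        ((h1.differentiable (by simp)).differentiableAt).hasFDerivAt).fderiv
    rw [this, ContinuousLinearMap.comp_apply, inner_riesz]
    exact hess x y

end riesz

section core

variable {d : ℕ} {V ζ : EuclideanSpace ℝ (Fin d) → ℝ} {α β : ℝ}

theorem Confining.integral_gen (hV : Confining V α ζ β)
    (e : OrthonormalBasis (Fin d) ℝ (EuclideanSpace ℝ (Fin d)))
    {u : EuclideanSpace ℝ (Fin d) → ℝ} {M : ℝ} (hu : Reg u M) :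
    ∫ x, Real.exp (-V x) * gen e (fun x => riesz e (fderiv ℝ V x)) u x = 0 := by
  have hα := hV.pos
  have hM := hu.nonneg
  have hVs := hV.contDiff_pot
  have hV1 := fderiv_contDiff hVs
  have hu1 := fderiv_contDiff hu.contDiff
  have hu2 := fderiv_contDiff hu1
  have hVc := hVs.continuous
  have c1 := hV1.continuous
  have c2 := hu1.continuous
  have c3 := hu2.continuous
  obtain ⟨C, hC⟩ := hV.exists_lower
  obtain ⟨M', hM'0, hM', -⟩ := exists_bounds hV.contDiff hV.compact
  have hu1b : ∀ i x, |fderiv ℝ u x (e i)| ≤ M := fun i x => by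
    have := (fderiv ℝ u x).le_opNorm (e i)
    rw [e.norm_eq_one, mul_one] at this
    exact this.trans (hu.d1 x)
  have hV1b : ∀ i x, |fderiv ℝ V x (e i)| ≤ α * ‖x‖ + M' := fun i x => by
    have := (fderiv ℝ V x).le_opNorm (e i)
    rw [e.norm_eq_one, mul_one] at this
    refine this.trans ?_
    rw [hV.fderiv_eq]
    refine (norm_add_le _ _).trans (add_le_add ?_ (hM' x))
    rw [norm_smul, innerSL_apply_norm, Real.norm_eq_abs, abs_of_pos hα]
  have i1 : ∀ i, Integrable fun x => Real.exp (-V x) * fderiv ℝ (fderiv ℝ u) x (e i) (e i) :=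
    fun i => integrable_exp_neg_mul (D := M) hα hVc hC (by fun_prop) fun x => by
      have := (fderiv ℝ (fderiv ℝ u) x).le_opNorm₂ (e i) (e i)
      rw [e.norm_eq_one, mul_one, mul_one] at this
      refine (this.trans (hu.d2 x)).trans ?_
      nlinarith [mul_nonneg hM (sq_nonneg ‖x‖)]
  have i2 : ∀ i, Integrable fun x => Real.exp (-V x) * (fderiv ℝ V x (e i) * fderiv ℝ u x (e i)) :=
    fun i => integrable_exp_neg_mul (D := (α + M') * M) hα hVc hC (by fun_prop) fun x => by
      rw [abs_mul]
      calc _ ≤ (α * ‖x‖ + M') * M := by gcongr; exacts [hV1b i x, hu1b i x]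
        _ ≤ (α * (1 + ‖x‖ ^ 2) + M' * (1 + ‖x‖ ^ 2)) * M := by
          gcongr
          · nlinarith [sq_nonneg (‖x‖ - 1), norm_nonneg x]
          · nlinarith [mul_nonneg hM'0 (sq_nonneg ‖x‖)]
        _ = _ := by ring
  have i3 : ∀ i, Integrable fun x => Real.exp (-V x) * fderiv ℝ u x (e i) :=
    fun i => integrable_exp_neg_mul (D := M) hα hVc hC (by fun_prop) fun x =>
      (hu1b i x).trans (by nlinarith [mul_nonneg hM (sq_nonneg ‖x‖)])
  have hexp : ∀ x v, fderiv ℝ (fun x => Real.exp (-V x)) x v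
      = -(Real.exp (-V x) * fderiv ℝ V x v) := by
    intro x v
    have h1 : HasFDerivAt (fun x => -V x) (-fderiv ℝ V x) x :=
      (hVs.differentiable (by simp)).differentiableAt.hasFDerivAt.neg
    rw [h1.exp.fderiv]
    simp
  have hdu : ∀ i x v, fderiv ℝ (fun x => fderiv ℝ u x (e i)) x v
      = fderiv ℝ (fderiv ℝ u) x v (e i) := by
    intro i x v
    rw [(((hu1.differentiable (by simp)).differentiableAt.hasFDerivAt).clm_apply
      (hasFDerivAt_const (e i) x)).fderiv]
    simp
  have ibp : ∀ i, ∫ x, Real.exp (-V x) * (fderiv ℝ V x (e i) * fderiv ℝ u x (e i))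
      = ∫ x, Real.exp (-V x) * fderiv ℝ (fderiv ℝ u) x (e i) (e i) := by
    intro i
    have := integral_mul_fderiv_eq_neg_fderiv_mul_of_integrable
      (μ := (volume : Measure (EuclideanSpace ℝ (Fin d)))) (f := fun x => fderiv ℝ u x (e i))
      (g := fun x => Real.exp (-V x)) (v := e i) ?_ ?_ ?_ ?_ ?_
    · simp only [hexp, hdu, mul_neg, integral_neg, neg_inj] at this
      refine (integral_congr_ae (Eventually.of_forall fun x => ?_)).trans
        (this.trans (integral_congr_ae (Eventually.of_forall fun x => ?_)))
      · ring
      · exact mul_comm _ (Real.exp (-V x))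
    · refine (i1 i).congr (Eventually.of_forall fun x => ?_)
      simp only [hdu]; exact mul_comm _ _
    · refine (i2 i).neg.congr (Eventually.of_forall fun x => ?_)
      simp only [hexp, Pi.neg_apply]; ring
    · refine (i3 i).congr (Eventually.of_forall fun x => ?_)
      exact mul_comm _ _
    · intro x _
      exact ((hu1.clm_apply contDiff_const).differentiable (by simp)).differentiableAt
    · intro x _
      exact ((hVs.neg.exp).differentiable (by simp)).differentiableAt
  have e1 : ∀ x, Real.exp (-V x) * gen e (fun x => riesz e (fderiv ℝ V x)) u x
      = ∑ i, (Real.exp (-V x) * fderiv ℝ (fderiv ℝ u) x (e i) (e i)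
        - Real.exp (-V x) * (fderiv ℝ V x (e i) * fderiv ℝ u x (e i))) := by
    intro x
    simp only [gen, riesz_apply, map_sum, map_smul, smul_eq_mul, Finset.sum_sub_distrib,
      Finset.mul_sum, mul_sub]
  simp_rw [e1]
  have e2 := integral_finsetSum Finset.univ fun i _ => (i1 i).sub (i2 i)
  simp only [Pi.sub_apply] at e2
  rw [e2]
  refine Finset.sum_eq_zero fun i _ => ?_
  rw [integral_sub (i1 i) (i2 i), ibp i, sub_self]

theorem Confining.invariant (hV : Confining V α ζ β)
    (e : OrthonormalBasis (Fin d) ℝ (EuclideanSpace ℝ (Fin d)))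
    (h1 : ∫ x, Real.exp (-V x) = 1) :
    Invariant e (fun x => riesz e (fderiv ℝ V x)) (gibbs V) := by
  have hVc := hV.contDiff_pot.continuous
  obtain ⟨C, hC⟩ := hV.exists_lower
  refine ⟨isProbabilityMeasure_gibbs h1, ?_, fun u M hu => ?_⟩
  · rw [integrable_gibbs hVc]
    refine integrable_exp_neg_mul (D := 1) hV.pos hVc hC (by fun_prop) fun x => ?_
    rw [abs_of_nonneg (sq_nonneg _)]
    linarith
  · rw [integral_gibbs hVc]
    exact hV.integral_gen e hu

/-- The Φ-Sobolev inequality for confining potentials and test functions which are constant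
outside a compact set. -/
theorem Confining.entropy_le (hd : 0 < d) (hV : Confining V α ζ β)
    (h1 : ∫ x, Real.exp (-V x) = 1) {ρ : ℝ} (hρ : 0 < ρ)
    (hess : ∀ x y, ρ * ‖y‖ ^ 2 ≤ fderiv ℝ (fderiv ℝ V) x y y)
    {Φ Φ₁ Φ₂ : ℝ → ℝ} {p q : ℝ}
    (hΦ₁ : ∀ t ∈ Set.Icc p q, HasDerivAt Φ (Φ₁ t) t)
    (hΦ₂ : ∀ t ∈ Set.Icc p q, HasDerivAt Φ₁ (Φ₂ t) t)
    (hc : ContinuousOn Φ₂ (Set.Icc p q)) (h0 : ∀ t ∈ Set.Icc p q, 0 ≤ Φ₂ t)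
    (hconv : ConvexOn ℝ (Set.Icc p q ×ˢ (Set.univ : Set ℝ))
      (fun z : ℝ × ℝ => Φ₂ z.1 * z.2 ^ 2))
    {f : EuclideanSpace ℝ (Fin d) → ℝ} {c : ℝ} (hf : ContDiff ℝ ∞ f)
    (hfc : HasCompactSupport fun x => f x - c) (hfJ : ∀ x, f x ∈ Set.Icc p q) :
    ∫ x, Φ (f x) ∂gibbs V - Φ (∫ x, f x ∂gibbs V)
      ≤ 1 / (2 * ρ) * ∫ x, Φ₂ (f x) * ‖fderiv ℝ f x‖ ^ 2 ∂gibbs V := by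
  set e := EuclideanSpace.basisFun (Fin d) ℝ
  obtain ⟨L, hb⟩ := hV.exists_drift e hess
  obtain ⟨K, hadm⟩ := admissible_Icc hΦ₁ hΦ₂ hc h0 hconv
  obtain ⟨M, hM⟩ := exists_reg hf hfc
  have hΦc : ContinuousOn Φ (Set.Icc p q) := fun t ht =>
    (hΦ₁ t ht).continuousAt.continuousWithinAt
  exact (hV.invariant e h1).entropy_le hb (exists_noise hd e) hρ hadm isClosed_Icc hΦc hM hfJ
    (approx_comp hf hfc hfJ hΦc) (approx_comp_mul e hf hfc hfJ hc)

end core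

end PhiSobolev

namespace PhiSobolev

open scoped ContDiff
open Filter Topology

section

variable {E : Type*} [NormedAddCommGroup E] [InnerProductSpace ℝ E]

theorem fderiv_radial {g m : ℝ → ℝ} (hg : ∀ s, HasDerivAt g (m s) s) :
    fderiv ℝ (fun x : E => g (‖x‖ ^ 2)) = fun x => (2 * m (‖x‖ ^ 2)) • innerSL ℝ x := by
  ext1 x
  have h := (hg (‖x‖ ^ 2)).comp_hasFDerivAt x (hasStrictFDerivAt_norm_sq x).hasFDerivAt
  refine h.fderiv.trans ?_
  ext y
  simp
  ring

theorem fderiv_fderiv_radial {g m m' : ℝ → ℝ} (hg : ∀ s, HasDerivAt g (m s) s)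
    (hm : ∀ s, HasDerivAt m (m' s) s) (x y : E) :
    fderiv ℝ (fderiv ℝ (fun x : E => g (‖x‖ ^ 2))) x y y =
      4 * m' (‖x‖ ^ 2) * inner ℝ x y ^ 2 + 2 * m (‖x‖ ^ 2) * ‖y‖ ^ 2 := by
  rw [fderiv_radial hg]
  have h := (((hm (‖x‖ ^ 2)).comp_hasFDerivAt x
    (hasStrictFDerivAt_norm_sq x).hasFDerivAt).const_mul 2).smul
    ((innerSL ℝ (E := E)).hasFDerivAt (x := x))
  have h' : fderiv ℝ (fun x : E => (2 * m (‖x‖ ^ 2)) • innerSL ℝ x) x = _ := h.fderiv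
  rw [h']
  have h1 : (innerSL ℝ y) y = ‖y‖ ^ 2 := real_inner_self_eq_norm_sq y
  have h2 : (innerSL ℝ x) y = inner ℝ x y := rfl
  simp only [_root_.add_apply, _root_.smul_apply, ContinuousLinearMap.smulRight_apply, h2,
    Function.comp_apply, smul_eq_mul, nsmul_eq_mul]
  refine (congrArg₂ (· + ·) (congrArg _ h1) rfl).trans ?_
  push_cast
  ring

theorem fderiv_fderiv_add {u v : E → ℝ} (hu : ContDiff ℝ ∞ u) (hv : ContDiff ℝ ∞ v) (x : E) :
    fderiv ℝ (fderiv ℝ (fun x => u x + v x)) x =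
      fderiv ℝ (fderiv ℝ u) x + fderiv ℝ (fderiv ℝ v) x := by
  have h : fderiv ℝ (fun x => u x + v x) = fun x => fderiv ℝ u x + fderiv ℝ v x := by
    ext1 x
    exact fderiv_fun_add (hu.differentiable (by simp)).differentiableAt
      (hv.differentiable (by simp)).differentiableAt
  rw [h]
  exact fderiv_fun_add ((fderiv_contDiff hu).differentiable (by simp)).differentiableAt
      ((fderiv_contDiff hv).differentiable (by simp)).differentiableAt

theorem fderiv_fderiv_const_mul {u : E → ℝ} (hu : ContDiff ℝ ∞ u) (c : ℝ) (x : E) :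
    fderiv ℝ (fderiv ℝ (fun x => c * u x)) x = c • fderiv ℝ (fderiv ℝ u) x := by
  have h : fderiv ℝ (fun x => c * u x) = fun x => c • fderiv ℝ u x := by
    ext1 x
    exact fderiv_const_mul (hu.differentiable (by simp)).differentiableAt c
  rw [h]
  exact fderiv_fun_const_smul ((fderiv_contDiff hu).differentiable (by simp)).differentiableAt c

/-- A smooth convex nondecreasing function vanishing up to `r` and affine with slope one
beyond `2 * r`. -/
theorem exists_convex_ramp {r : ℝ} (hr : 0 < r) :
    ∃ (g m m' : ℝ → ℝ) (c : ℝ), (∀ s, HasDerivAt g (m s) s) ∧ (∀ s, HasDerivAt m (m' s) s) ∧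
      ContDiff ℝ ∞ g ∧ (∀ s, 0 ≤ m s) ∧ (∀ s, 0 ≤ m' s) ∧ (∀ s, 0 ≤ s → s ≤ r → g s = 0) ∧
      (∀ s, 2 * r ≤ s → m s = 1) ∧ ∀ s, 2 * r ≤ s → g s = s - c := by
  set m : ℝ → ℝ := fun s => Real.smoothTransition ((s - r) / r) with hm
  have hmc : ContDiff ℝ ∞ m :=
    Real.smoothTransition.contDiff.comp ((contDiff_id.sub contDiff_const).div_const r)
  have hmono : Monotone m := fun a b hab => by
    apply Real.smoothTransition.monotone
    gcongr
  have hg : ∀ s, HasDerivAt (fun s => ∫ t in (0 : ℝ)..s, m t) (m s) s := fun s =>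
    (hmc.continuous.integral_hasStrictDerivAt 0 s).hasDerivAt
  have h1 : ∀ s, 2 * r ≤ s → m s = 1 := fun s hs => by
    apply Real.smoothTransition.one_of_one_le
    rw [le_div_iff₀ hr]
    linarith
  have h0 : ∀ s, s ≤ r → m s = 0 := fun s hs => by
    apply Real.smoothTransition.zero_of_nonpos
    exact div_nonpos_of_nonpos_of_nonneg (by linarith) hr.le
  refine ⟨fun s => ∫ t in (0 : ℝ)..s, m t, m, deriv m, 2 * r - ∫ t in (0 : ℝ)..(2 * r), m t, hg,
    fun s => ((hmc.differentiable (by simp)) s).hasDerivAt, ?_,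
    fun s => Real.smoothTransition.nonneg _, fun s => hmono.deriv_nonneg, ?_, h1, ?_⟩
  · rw [contDiff_infty_iff_deriv]
    refine ⟨fun s => (hg s).differentiableAt, ?_⟩
    rwa [funext fun s => (hg s).deriv]
  · intro s hs0 hs
    beta_reduce
    rw [intervalIntegral.integral_congr (g := fun _ => 0) fun t ht => h0 t ?_]
    · simp
    · rw [Set.uIcc_of_le hs0] at ht
      exact ht.2.trans hs
  · intro s hs
    have e1 := intervalIntegral.integral_add_adjacent_intervals
      (hmc.continuous.intervalIntegrable (μ := volume) 0 (2 * r))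
      (hmc.continuous.intervalIntegrable (μ := volume) (2 * r) s)
    have e2 : ∫ t in (2 * r)..s, m t = s - 2 * r := by
      rw [intervalIntegral.integral_congr (g := fun _ => 1) fun t ht => h1 t ?_]
      · simp
      · rw [Set.uIcc_of_le hs] at ht
        exact ht.1
    simp only
    linarith

theorem exists_truncation [FiniteDimensional ℝ E] {H : E → ℝ} (hH : ContDiff ℝ ∞ H) {ρ : ℝ}
    (hρ : 0 < ρ) (hess : ∀ x y, ρ * ‖y‖ ^ 2 ≤ fderiv ℝ (fderiv ℝ H) x y y) {R : ℝ} (hR : 0 < R) :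
    ∃ V α ζ β, Confining V α ζ β ∧ (∀ x y, ρ * ‖y‖ ^ 2 ≤ fderiv ℝ (fderiv ℝ V) x y y) ∧
      ∀ x, ‖x‖ ≤ R → V x = H x := by
  obtain ⟨g, m, m', c, hg, hm, hgc, hm0, hm'0, hg0, hm1, hg1⟩ :=
    exists_convex_ramp (r := R ^ 2) (by positivity)
  let χ : ContDiffBump (0 : E) := ⟨2 * R, 3 * R, by linarith, by linarith⟩
  set W : E → ℝ := fun x => H x - ρ / 2 * ‖x‖ ^ 2 with hW
  have hWc : ContDiff ℝ ∞ W := hH.sub (contDiff_const.mul (contDiff_norm_sq ℝ))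
  set w : E → ℝ := fun x => χ x * W x with hw
  have hwc : ContDiff ℝ ∞ w := χ.contDiff.mul hWc
  have hws : HasCompactSupport w := χ.hasCompactSupport.mul_right
  obtain ⟨K, hK0, -, hK, -⟩ := exists_bounds hwc hws
  set θ : E → ℝ := fun x => g (‖x‖ ^ 2) with hθ
  have hθc : ContDiff ℝ ∞ θ := hgc.comp (contDiff_norm_sq ℝ)
  set q : E → ℝ := fun x => ρ / 2 * ‖x‖ ^ 2 with hq
  have hqc : ContDiff ℝ ∞ q := contDiff_const.mul (contDiff_norm_sq ℝ)
  have hqd : ∀ x y, fderiv ℝ (fderiv ℝ q) x y y = ρ * ‖y‖ ^ 2 := fun x y => by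
    have := fderiv_fderiv_radial (E := E) (g := fun s => ρ / 2 * s) (m := fun _ => ρ / 2)
      (m' := fun _ => 0) (fun s => by simpa using (hasDerivAt_id s).const_mul (ρ / 2))
      (fun s => hasDerivAt_const s _) x y
    rw [hq, this]
    ring
  have hθd : ∀ x y, fderiv ℝ (fderiv ℝ θ) x y y = _ := fderiv_fderiv_radial hg hm
  refine ⟨fun x => (q x + w x) + K * θ x, ρ + 2 * K, fun x => w x + K * (θ x - ‖x‖ ^ 2 + c),
    -(K * c), ⟨fun x => ?_, by positivity, ?_, ?_⟩, fun x y => ?_, fun x hx => ?_⟩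
  · simp only [hq]
    ring
  · exact hwc.add (contDiff_const.mul ((hθc.sub (contDiff_norm_sq ℝ)).add contDiff_const))
  · refine hws.add (HasCompactSupport.mul_left
      (HasCompactSupport.intro (isCompact_closedBall (0 : E) (2 * R)) fun x hx => ?_))
    simp only [Metric.mem_closedBall, dist_zero_right, not_le] at hx
    simp only [hθ]
    rw [hg1 _ (by nlinarith)]
    ring
  · rw [fderiv_fderiv_add (hqc.add hwc) (contDiff_const.mul hθc), fderiv_fderiv_const_mul hθc]
    simp only [_root_.add_apply, _root_.smul_apply, smul_eq_mul, hθd]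
    rcases lt_or_ge ‖x‖ (2 * R) with hx | hx
    · have h1 : (fun x => q x + w x) =ᶠ[𝓝 x] H := by
        have := χ.eventuallyEq_one_of_mem_ball (x := x) (by simpa [χ] using hx)
        filter_upwards [this] with z hz
        simp only [hq, hw, hW, hz, Pi.one_apply]
        ring
      rw [h1.fderiv.fderiv_eq]
      have h2 := hess x y
      have h3 := hm0 (‖x‖ ^ 2)
      have h4 := hm'0 (‖x‖ ^ 2)
      have : 0 ≤ K * (4 * m' (‖x‖ ^ 2) * inner ℝ x y ^ 2 + 2 * m (‖x‖ ^ 2) * ‖y‖ ^ 2) := by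
        positivity
      linarith
    · rw [fderiv_fderiv_add hqc hwc, _root_.add_apply, _root_.add_apply, hqd,
        hm1 _ (by nlinarith)]
      have h4 := hm'0 (‖x‖ ^ 2)
      have h5 : |fderiv ℝ (fderiv ℝ w) x y y| ≤ K * ‖y‖ * ‖y‖ :=
        ((fderiv ℝ (fderiv ℝ w) x).le_opNorm₂ y y).trans (by gcongr; exact hK x)
      have h6 : 0 ≤ K * (4 * m' (‖x‖ ^ 2) * inner ℝ x y ^ 2) := by positivity
      have h7 := (abs_le.mp h5).1
      have h8 : 0 ≤ K * ‖y‖ ^ 2 := by positivity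
      nlinarith
  · have : χ x = 1 := χ.one_of_mem_closedBall (by simp [χ]; linarith)
    simp only [hq, hw, hW, hθ, this]
    rw [hg0 _ (by positivity) (by gcongr)]
    ring

theorem quadratic_lower {V : E → ℝ} (hV : ContDiff ℝ ∞ V) {ρ : ℝ}
    (hess : ∀ x y, ρ * ‖y‖ ^ 2 ≤ fderiv ℝ (fderiv ℝ V) x y y) (x : E) :
    V 0 + fderiv ℝ V 0 x + ρ / 2 * ‖x‖ ^ 2 ≤ V x := by
  have hd1 : ∀ t : ℝ, HasDerivAt (fun t : ℝ => fderiv ℝ V (t • x) x)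
      (fderiv ℝ (fderiv ℝ V) (t • x) x x) t := fun t => by
    have h1 := ((fderiv_contDiff hV).differentiable (by simp) (t • x)).hasFDerivAt.comp_hasDerivAt t
      ((hasDerivAt_id t).smul_const x)
    simpa using h1.clm_apply (hasDerivAt_const t x)
  have hd0 : ∀ t : ℝ, HasDerivAt (fun t : ℝ => V (t • x)) (fderiv ℝ V (t • x) x) t := fun t => by
    have h1 := (hV.differentiable (by simp) (t • x)).hasFDerivAt.comp_hasDerivAt t
      ((hasDerivAt_id t).smul_const x)
    rw [one_smul] at h1
    exact h1
  have m1 : Monotone fun t : ℝ => fderiv ℝ V (t • x) x - t * (ρ * ‖x‖ ^ 2) := by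
    have hh : ∀ t : ℝ, HasDerivAt (fun t : ℝ => fderiv ℝ V (t • x) x - t * (ρ * ‖x‖ ^ 2))
        (fderiv ℝ (fderiv ℝ V) (t • x) x x - 1 * (ρ * ‖x‖ ^ 2)) t := fun t =>
      (hd1 t).sub ((hasDerivAt_id t).mul_const _)
    refine monotone_of_deriv_nonneg (fun t => (hh t).differentiableAt) fun t => ?_
    rw [(hh t).deriv]
    have := hess (t • x) x
    linarith
  have m2 : MonotoneOn (fun t : ℝ => V (t • x) - t * fderiv ℝ V 0 x - t ^ 2 * (ρ / 2 * ‖x‖ ^ 2))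
      (Set.Icc 0 1) := by
    have hh : ∀ t : ℝ, HasDerivAt
        (fun t : ℝ => V (t • x) - t * fderiv ℝ V 0 x - t ^ 2 * (ρ / 2 * ‖x‖ ^ 2))
        (fderiv ℝ V (t • x) x - 1 * fderiv ℝ V 0 x - (2 * t) * (ρ / 2 * ‖x‖ ^ 2)) t := fun t => by
      have h3 : HasDerivAt (fun t : ℝ => t ^ 2) (2 * t) t := by simpa using hasDerivAt_pow 2 t
      exact ((hd0 t).sub ((hasDerivAt_id t).mul_const _)).sub (h3.mul_const _)
    refine monotoneOn_of_deriv_nonneg (convex_Icc 0 1)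
      (fun t _ => (hh t).continuousAt.continuousWithinAt)
      (fun t _ => (hh t).differentiableAt.differentiableWithinAt) fun t ht => ?_
    rw [interior_Icc] at ht
    rw [(hh t).deriv]
    have := m1 ht.1.le
    simp only [zero_smul] at this
    linarith
  have := m2 (Set.left_mem_Icc.2 zero_le_one) (Set.right_mem_Icc.2 zero_le_one) zero_le_one
  simp only [zero_smul, one_smul] at this
  linarith

end

end PhiSobolev

namespace PhiSobolev

open scoped ContDiff
open Filter Topology

section

variable {d : ℕ}

/-- A uniformly convex potential is a limit of confining ones, with convergence of expectations
of uniformly bounded, pointwise convergent observables. -/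
theorem exists_confining_approx {H : EuclideanSpace ℝ (Fin d) → ℝ} (hH : ContDiff ℝ ∞ H) {ρ : ℝ}
    (hρ : 0 < ρ) (hess : ∀ x y, ρ * ‖y‖ ^ 2 ≤ fderiv ℝ (fderiv ℝ H) x y y)
    (h1 : ∫ x, Real.exp (-H x) = 1) :
    ∃ (V : ℕ → EuclideanSpace ℝ (Fin d) → ℝ) (α : ℕ → ℝ) (ζ : ℕ → EuclideanSpace ℝ (Fin d) → ℝ)
      (β : ℕ → ℝ), (∀ n, Confining (V n) (α n) (ζ n) (β n)) ∧
      (∀ n, ∫ x, Real.exp (-V n x) = 1) ∧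
      (∀ n x y, ρ * ‖y‖ ^ 2 ≤ fderiv ℝ (fderiv ℝ (V n)) x y y) ∧
      ∀ (g : ℕ → EuclideanSpace ℝ (Fin d) → ℝ) (g' : EuclideanSpace ℝ (Fin d) → ℝ) (C : ℝ),
        (∀ n, Continuous (g n)) → (∀ n x, |g n x| ≤ C) →
        (∀ x, Tendsto (fun n => g n x) atTop (𝓝 (g' x))) →
        Tendsto (fun n => ∫ x, g n x ∂gibbs (V n)) atTop (𝓝 (∫ x, g' x ∂gibbs H)) := by
  choose U α ζ β hU hUh hUH using fun n : ℕ =>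
    exists_truncation hH hρ hess (R := (n : ℝ) + 1) (by positivity)
  have hUc := fun n => (hU n).contDiff_pot
  set D : EuclideanSpace ℝ (Fin d) → ℝ := fun x =>
    Real.exp (-H 0) * Real.exp (-(ρ / 2) * ‖x‖ ^ 2 +
      inner ℝ (-(InnerProductSpace.toDual ℝ _).symm (fderiv ℝ H 0)) x) with hD
  have hDi : Integrable D := (integrable_exp_quadratic (by positivity) _).const_mul _
  have hUD : ∀ n x, Real.exp (-U n x) ≤ D x := fun n x => by
    have hl := quadratic_lower (hUc n) (hUh n) x
    have e0 : U n 0 = H 0 := hUH n 0 (by simp; positivity)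
    have e1 : fderiv ℝ (U n) 0 = fderiv ℝ H 0 := by
      refine Filter.EventuallyEq.fderiv_eq ?_
      filter_upwards [Metric.ball_mem_nhds (0 : EuclideanSpace ℝ (Fin d))
        (show (0 : ℝ) < (n : ℝ) + 1 by positivity)] with z hz
      exact hUH n z (by simpa using (mem_ball_zero_iff.1 hz).le)
    rw [e0, e1] at hl
    rw [hD]
    simp only [inner_neg_left, InnerProductSpace.toDual_symm_apply]
    rw [← Real.exp_add, Real.exp_le_exp]
    linarith
  have hlim : ∀ x, ∀ᶠ n : ℕ in atTop, U n x = H x := fun x => by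
    obtain ⟨N, hN⟩ := exists_nat_ge ‖x‖
    filter_upwards [eventually_ge_atTop N] with n hn
    refine hUH n x (hN.trans ?_)
    have : (N : ℝ) ≤ n := by exact_mod_cast hn
    linarith
  have hUi : ∀ n, Integrable fun x => Real.exp (-U n x) := fun n =>
    hDi.mono' (by have := (hUc n).continuous; fun_prop) (Eventually.of_forall fun x => by
      rw [Real.norm_eq_abs, abs_of_pos (Real.exp_pos _)]; exact hUD n x)
  have key : ∀ (g : ℕ → EuclideanSpace ℝ (Fin d) → ℝ) (g' : EuclideanSpace ℝ (Fin d) → ℝ) (C : ℝ),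
        (∀ n, Continuous (g n)) → (∀ n x, |g n x| ≤ C) →
        (∀ x, Tendsto (fun n => g n x) atTop (𝓝 (g' x))) →
        Tendsto (fun n => ∫ x, Real.exp (-U n x) * g n x) atTop
          (𝓝 (∫ x, Real.exp (-H x) * g' x)) := by
    intro g g' C hg hC hlg
    refine tendsto_integral_of_dominated_convergence (fun x => D x * C) (fun n => ?_)
      (hDi.mul_const C) (fun n => Eventually.of_forall fun x => ?_)
      (Eventually.of_forall fun x => ?_)
    · have := (hUc n).continuous
      have := hg n
      fun_prop
    · rw [norm_mul, Real.norm_eq_abs, Real.norm_eq_abs, abs_of_pos (Real.exp_pos _)]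
      exact mul_le_mul (hUD n x) (hC n x) (abs_nonneg _) ((Real.exp_pos _).le.trans (hUD n x))
    · refine Tendsto.mul (tendsto_const_nhds.congr' ?_) (hlg x)
      filter_upwards [hlim x] with n hn
      rw [hn]
  set Z : ℕ → ℝ := fun n => ∫ x, Real.exp (-U n x) with hZ
  have hZpos : ∀ n, 0 < Z n := fun n => integral_exp_pos (hUi n)
  have hZlim : Tendsto Z atTop (𝓝 1) := by
    have := key (fun _ _ => 1) (fun _ => 1) 1 (fun n => continuous_const) (by simp)
      (fun x => tendsto_const_nhds)
    simpa [h1] using this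
  have hexp : ∀ n x, Real.exp (-(U n x + Real.log (Z n))) = (Z n)⁻¹ * Real.exp (-U n x) :=
    fun n x => by
      rw [neg_add, Real.exp_add, Real.exp_neg (Real.log _), Real.exp_log (hZpos n), mul_comm]
  refine ⟨fun n x => U n x + Real.log (Z n), α, ζ, fun n => β n + Real.log (Z n), fun n =>
    ⟨fun x => ?_, (hU n).pos, (hU n).contDiff, (hU n).compact⟩, fun n => ?_, fun n x y => ?_, ?_⟩
  · beta_reduce
    rw [(hU n).eq]
    ring
  · simp only [hexp]
    rw [integral_const_mul]
    exact inv_mul_cancel₀ (hZpos n).ne'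
  · have e : fderiv ℝ (fun x => U n x + Real.log (Z n)) = fderiv ℝ (U n) := by
      ext1 x; exact fderiv_add_const _
    rw [e]
    exact hUh n x y
  · intro g g' C hg hC hlg
    rw [integral_gibbs hH.continuous]
    have h2 := (hZlim.inv₀ one_ne_zero).mul (key g g' C hg hC hlg)
    rw [inv_one, one_mul] at h2
    refine h2.congr fun n => ?_
    rw [integral_gibbs (V := fun x => U n x + Real.log (Z n))
      ((hUc n).continuous.add continuous_const), ← integral_const_mul]
    refine integral_congr_ae (Eventually.of_forall fun x => ?_)
    simp only [hexp]
    ring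

theorem exists_cutoff (E : Type*) [NormedAddCommGroup E] [InnerProductSpace ℝ E]
    [FiniteDimensional ℝ E] :
    ∃ (χ : ℕ → E → ℝ) (B : ℝ), 0 ≤ B ∧ (∀ n, ContDiff ℝ ∞ (χ n)) ∧
      (∀ n, HasCompactSupport (χ n)) ∧
      (∀ n x, χ n x ∈ Set.Icc (0 : ℝ) 1) ∧ (∀ n x, ‖fderiv ℝ (χ n) x‖ ≤ B) ∧
      ∀ x, ∀ᶠ n in atTop, χ n =ᶠ[𝓝 x] fun _ => 1 := by
  let χ : ContDiffBump (0 : E) := ⟨1, 2, one_pos, one_lt_two⟩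
  obtain ⟨B, hB0, hB, -⟩ := exists_bounds χ.contDiff χ.hasCompactSupport
  have hpos : ∀ n : ℕ, (0 : ℝ) < (n : ℝ) + 1 := fun n => by positivity
  refine ⟨fun n x => χ (((n : ℝ) + 1)⁻¹ • x), B, hB0, fun n => ?_, fun n => ?_, fun n x =>
    ⟨χ.nonneg, χ.le_one⟩, fun n x => ?_, fun x => ?_⟩
  · exact χ.contDiff.comp (contDiff_const_smul _)
  · exact χ.hasCompactSupport.comp_smul (inv_ne_zero (hpos n).ne')
  · beta_reduce
    have h := ((show ContDiff ℝ ∞ χ from χ.contDiff).differentiable (by simp)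
      (((n : ℝ) + 1)⁻¹ • x)).hasFDerivAt.comp x
      ((hasFDerivAt_id (𝕜 := ℝ) x).const_smul (((n : ℝ) + 1)⁻¹))
    have h' : fderiv ℝ (fun x => χ (((n : ℝ) + 1)⁻¹ • x)) x = _ := h.fderiv
    rw [h', ContinuousLinearMap.comp_smul, norm_smul, ContinuousLinearMap.comp_id, norm_inv,
      Real.norm_of_nonneg (hpos n).le]
    have h1 : ((n : ℝ) + 1)⁻¹ ≤ 1 := inv_le_one_of_one_le₀ (by simp)
    calc _ ≤ 1 * B := by
          gcongr
          exact hB _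
      _ = B := one_mul B
  · obtain ⟨N, hN⟩ := exists_nat_ge ‖x‖
    filter_upwards [eventually_ge_atTop N] with n hn
    have hxn : ‖x‖ < (n : ℝ) + 1 := by
      have : (N : ℝ) ≤ n := by exact_mod_cast hn
      linarith
    filter_upwards [continuous_norm.continuousAt.eventually_lt continuousAt_const hxn] with z hz
    refine χ.one_of_mem_closedBall ?_
    rw [mem_closedBall_zero_iff, norm_smul, norm_inv, Real.norm_of_nonneg (hpos n).le,
      inv_mul_le_iff₀ (hpos n)]
    simpa [χ] using hz.le

/-- Cut-offs of a bounded smooth function, pulled towards the value `c`. -/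
theorem exists_cutoff_approx {E : Type*} [NormedAddCommGroup E] [InnerProductSpace ℝ E]
    [FiniteDimensional ℝ E] {f : E → ℝ} (hf : ContDiff ℝ ∞ f) {a b c : ℝ}
    (hfab : ∀ x, f x ∈ Set.Icc a b) (hc : c ∈ Set.Icc a b) {G : ℝ}
    (hG : ∀ x, ‖fderiv ℝ f x‖ ≤ G) :
    ∃ (u : ℕ → E → ℝ) (B : ℝ), (∀ n, ContDiff ℝ ∞ (u n)) ∧
      (∀ n, HasCompactSupport fun x => u n x - c) ∧
      (∀ (n : ℕ) (x), u n x ∈ Set.Icc (a + 1 / ((n : ℝ) + 1) * (c - a))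
        (b + 1 / ((n : ℝ) + 1) * (c - b))) ∧
      (∀ n x, ‖fderiv ℝ (u n) x‖ ≤ B) ∧
      (∀ x, Tendsto (fun n => u n x) atTop (𝓝 (f x))) ∧
      (∀ x, Tendsto (fun n => fderiv ℝ (u n) x) atTop (𝓝 (fderiv ℝ f x))) ∧
      ∀ x, fderiv ℝ f x = 0 → ∀ᶠ n in atTop, fderiv ℝ (u n) x = 0 := by
  obtain ⟨χ, B, hB0, hχ, hχs, hχ1, hχB, hχe⟩ := exists_cutoff E
  set l : ℕ → ℝ := fun n => 1 - 1 / ((n : ℝ) + 1) with hl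
  have hl01 : ∀ n, 0 ≤ l n ∧ l n ≤ 1 := fun n => by
    have h1 : 1 / ((n : ℝ) + 1) ≤ 1 := by
      rw [div_le_one (by positivity)]
      simp
    have h2 : 0 ≤ 1 / ((n : ℝ) + 1) := by positivity
    constructor <;> simp only [hl] <;> linarith
  have hllim : Tendsto l atTop (𝓝 1) := by
    simpa [hl] using (tendsto_const_nhds (x := (1 : ℝ))).sub
      (tendsto_one_div_add_atTop_nhds_zero_nat (𝕜 := ℝ))
  have hab : a ≤ b := hc.1.trans hc.2
  set u : ℕ → E → ℝ := fun n x => c + l n * (χ n x * (f x - c)) with hu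
  have hder : ∀ n x, HasFDerivAt (u n)
      (l n • (χ n x • fderiv ℝ f x + (f x - c) • fderiv ℝ (χ n) x)) x := fun n x =>
    ((((hχ n).differentiable (by simp) x).hasFDerivAt.mul
      ((hf.differentiable (by simp) x).hasFDerivAt.sub_const c)).const_mul (l n)).const_add c
  have hue : ∀ x, ∀ᶠ n in atTop, u n =ᶠ[𝓝 x] fun z => c + l n * (f z - c) := fun x => by
    filter_upwards [hχe x] with n hn
    filter_upwards [hn] with z hz
    simp only [hu, hz, one_mul]
  have hfe : ∀ x, ∀ᶠ n in atTop, fderiv ℝ (u n) x = l n • fderiv ℝ f x := fun x => by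
    filter_upwards [hue x] with n hn
    rw [hn.fderiv_eq]
    exact ((((hf.differentiable (by simp) x).hasFDerivAt.sub_const c).const_mul
      (l n)).const_add c).fderiv
  refine ⟨u, G + (b - a) * B, fun n => ?_, fun n => ?_, fun n x => ?_, fun n x => ?_, fun x => ?_,
    fun x => ?_, fun x hx => ?_⟩
  · exact contDiff_const.add (contDiff_const.mul ((hχ n).mul (hf.sub contDiff_const)))
  · simp only [hu, add_sub_cancel_left]
    exact (hχs n).mul_right.mul_left
  · obtain ⟨h0, h1⟩ := hl01 n
    obtain ⟨h2, h3⟩ := hχ1 n x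
    obtain ⟨h4, h5⟩ := hfab x
    obtain ⟨h6, h7⟩ := hc
    have e1 : a + 1 / ((n : ℝ) + 1) * (c - a) = c + l n * (a - c) := by simp only [hl]; ring
    have e2 : b + 1 / ((n : ℝ) + 1) * (c - b) = c + l n * (b - c) := by simp only [hl]; ring
    rw [e1, e2]
    have h8 : a - c ≤ χ n x * (f x - c) := by nlinarith
    have h9 : χ n x * (f x - c) ≤ b - c := by nlinarith
    constructor <;> simp only [hu] <;> gcongr
  · rw [(hder n x).fderiv, norm_smul, Real.norm_of_nonneg (hl01 n).1]
    have hG0 : 0 ≤ G := (norm_nonneg _).trans (hG x)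
    have h1 : ‖χ n x • fderiv ℝ f x‖ ≤ G := by
      rw [norm_smul, Real.norm_of_nonneg (hχ1 n x).1]
      calc _ ≤ 1 * G := by
            gcongr
            · exact (hχ1 n x).2
            · exact hG x
        _ = G := one_mul G
    have h2 : ‖(f x - c) • fderiv ℝ (χ n) x‖ ≤ (b - a) * B := by
      rw [norm_smul, Real.norm_eq_abs]
      have : |f x - c| ≤ b - a := by
        rw [abs_le]
        constructor <;> linarith [(hfab x).1, (hfab x).2, hc.1, hc.2]
      gcongr
      exact hχB n x
    calc _ ≤ 1 * (G + (b - a) * B) := by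
          refine mul_le_mul (hl01 n).2 ((norm_add_le _ _).trans (add_le_add h1 h2))
            (norm_nonneg _) zero_le_one
      _ = _ := one_mul _
  · have h : Tendsto (fun n => c + l n * (f x - c)) atTop (𝓝 (c + 1 * (f x - c))) :=
      (hllim.mul_const _).const_add c
    rw [one_mul, add_sub_cancel] at h
    refine h.congr' ?_
    filter_upwards [hue x] with n hn
    exact hn.eq_of_nhds.symm
  · have h := hllim.smul_const (fderiv ℝ f x)
    rw [one_smul] at h
    refine h.congr' ?_
    filter_upwards [hfe x] with n hn
    exact hn.symm
  · filter_upwards [hfe x] with n hn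
    rw [hn, hx, smul_zero]

theorem fderiv_eq_zero_of_notMem_interior {E : Type*} [NormedAddCommGroup E] [NormedSpace ℝ E]
    {f : E → ℝ} {I : Set ℝ} (hI : Convex ℝ I) (hfI : ∀ x, f x ∈ I) {x : E}
    (hx : f x ∉ interior I) : fderiv ℝ f x = 0 := by
  by_cases h1 : ∀ z, f x ≤ f z
  · exact IsLocalMin.fderiv_eq_zero (Eventually.of_forall h1)
  by_cases h2 : ∀ z, f z ≤ f x
  · exact IsLocalMax.fderiv_eq_zero (Eventually.of_forall h2)
  push Not at h1 h2
  obtain ⟨y, hy⟩ := h1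
  obtain ⟨z, hz⟩ := h2
  exact absurd (mem_interior_iff_mem_nhds.2 (mem_of_superset (Icc_mem_nhds hy hz)
    (hI.ordConnected.out (hfI y) (hfI z)))) hx

theorem abs_deriv_deriv_le {Φ : ℝ → ℝ} {I J : Set ℝ} (hI : Convex ℝ I)
    (hne : (interior I).Nonempty) (hΦ : ContDiffOn ℝ 2 Φ I) (hJ : IsCompact J) (hJI : J ⊆ I) :
    ∃ B, ∀ t ∈ J ∩ interior I, |deriv (deriv Φ) t| ≤ B := by
  obtain ⟨B, hB⟩ := hJ.exists_bound_of_continuousOn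
    ((hΦ.continuousOn_iteratedDerivWithin (m := 2) (by norm_num)
      (uniqueDiffOn_convex hI hne)).mono hJI)
  refine ⟨B, fun t ht => ?_⟩
  have e : iteratedDerivWithin 2 Φ I t = deriv (deriv Φ) t := by
    rw [iteratedDerivWithin, iteratedFDerivWithin_congr_set (t := Set.univ), ← iteratedDerivWithin,
      iteratedDerivWithin_univ, iteratedDeriv_succ, iteratedDeriv_one]
    exact eventuallyEq_univ.2 (mem_interior_iff_mem_nhds.1 ht.2)
  rw [← e]
  exact hB t ht.1

end

end PhiSobolev

namespace PhiSobolev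

open scoped ContDiff
open Filter Topology

/-- The Φ-Sobolev inequality when the range of `f` is not contained in a single boundary point. -/
theorem entropy_le_of_nonempty_interior {d : ℕ} (hd : 0 < d) {ρ : ℝ} (hρ : 0 < ρ)
    {H : EuclideanSpace ℝ (Fin d) → ℝ} (hH : ContDiff ℝ ∞ H)
    (hess : ∀ x y, ρ * ‖y‖ ^ 2 ≤ fderiv ℝ (fderiv ℝ H) x y y)
    (h1 : ∫ x, Real.exp (-H x) = 1) {I : Set ℝ} (hI : Convex ℝ I) (hIc : IsClosed I)
    (hne : (interior I).Nonempty) {Φ : ℝ → ℝ} (hΦ : ContDiffOn ℝ 2 Φ I)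
    (h0 : ∀ u ∈ I, 0 ≤ deriv (deriv Φ) u)
    (hconv : ConvexOn ℝ (I ×ˢ (Set.univ : Set ℝ))
      (fun p : ℝ × ℝ => deriv (deriv Φ) p.1 * p.2 ^ 2))
    {f : EuclideanSpace ℝ (Fin d) → ℝ} (hf : ContDiff ℝ ∞ f) (hfI : ∀ x, f x ∈ I)
    {C : ℝ} (hC : ∀ x, |f x| ≤ C) {G : ℝ} (hG : ∀ x, ‖fderiv ℝ f x‖ ≤ G) :
    ∫ x, Φ (f x) ∂gibbs H - Φ (∫ x, f x ∂gibbs H) ≤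
      1 / (2 * ρ) * ∫ x, deriv (deriv Φ) (f x) * ‖fderiv ℝ f x‖ ^ 2 ∂gibbs H := by
  obtain ⟨c, hcI⟩ := hne
  obtain ⟨a, b, haI, hbI, hfab, hcab⟩ : ∃ a b, a ∈ I ∧ b ∈ I ∧ (∀ x, f x ∈ Set.Icc a b) ∧
      c ∈ Set.Icc a b := by
    set C' := max C |c| with hC'
    set J := I ∩ Set.Icc (-C') C' with hJ
    have hcJ : c ∈ J := ⟨interior_subset hcI, abs_le.1 (le_max_right _ _)⟩
    have hJc : IsCompact J := isCompact_Icc.inter_left hIc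
    have hJe : J = Set.Icc (sInf J) (sSup J) := eq_Icc_of_connected_compact
      ⟨⟨c, hcJ⟩, (hI.inter (convex_Icc _ _)).isPreconnected⟩ hJc
    refine ⟨sInf J, sSup J, (hJc.sInf_mem ⟨c, hcJ⟩).1, (hJc.sSup_mem ⟨c, hcJ⟩).1, fun x => ?_, ?_⟩
    · rw [← hJe]
      exact ⟨hfI x, abs_le.1 ((hC x).trans (le_max_left _ _))⟩
    · rwa [← hJe]
  have hJI : Set.Icc a b ⊆ I := hI.ordConnected.out haI hbI
  obtain ⟨V, α, ζ, β, hV, hV1, hVh, hVlim⟩ := exists_confining_approx hH hρ hess h1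
  obtain ⟨u, B, hu, hus, hup, huB, hulim, hudlim, hud0⟩ := exists_cutoff_approx hf hfab hcab hG
  have hB0 : 0 ≤ B := (norm_nonneg _).trans (huB 0 0)
  have ht : ∀ n : ℕ, 0 < 1 / ((n : ℝ) + 1) ∧ 1 / ((n : ℝ) + 1) ≤ 1 := fun n => by
    refine ⟨by positivity, ?_⟩
    rw [div_le_one (by positivity)]
    simp
  have hpq : ∀ n : ℕ, Set.Icc (a + 1 / ((n : ℝ) + 1) * (c - a)) (b + 1 / ((n : ℝ) + 1) * (c - b)) ⊆
      interior I := fun n => hI.interior.ordConnected.out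
    (hI.add_smul_sub_mem_interior haI hcI (ht n)) (hI.add_smul_sub_mem_interior hbI hcI (ht n))
  have huab : ∀ n x, u n x ∈ Set.Icc a b := fun n x => by
    obtain ⟨h2, h3⟩ := hup n x
    obtain ⟨h4, h5⟩ := ht n
    obtain ⟨h6, h7⟩ := hcab
    constructor <;> nlinarith
  have hin : ∀ n x, u n x ∈ interior I := fun n x => hpq n (hup n x)
  obtain ⟨hdΦ, -, hΦ'⟩ := (contDiffOn_succ_iff_deriv_of_isOpen (n := 1) isOpen_interior).1
    ((hΦ.mono interior_subset).of_le (by norm_num))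
  obtain ⟨hdΦ', -, hΦ''⟩ := (contDiffOn_succ_iff_deriv_of_isOpen (n := 0) isOpen_interior).1
    (hΦ'.of_le (by norm_num))
  have hD := hΦ''.continuousOn
  have hineq : ∀ n, ∫ x, Φ (u n x) ∂gibbs (V n) - Φ (∫ x, u n x ∂gibbs (V n)) ≤
      1 / (2 * ρ) * ∫ x, deriv (deriv Φ) (u n x) * ‖fderiv ℝ (u n) x‖ ^ 2 ∂gibbs (V n) := fun n =>
    (hV n).entropy_le hd (hV1 n) hρ (hVh n)
      (fun t ht => (hdΦ.differentiableAt (isOpen_interior.mem_nhds (hpq n ht))).hasDerivAt)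
      (fun t ht => (hdΦ'.differentiableAt (isOpen_interior.mem_nhds (hpq n ht))).hasDerivAt)
      (hD.mono (hpq n)) (fun t ht => h0 t (interior_subset (hpq n ht)))
      (hconv.subset (Set.prod_mono ((hpq n).trans interior_subset) subset_rfl)
        ((convex_Icc _ _).prod convex_univ))
      (hu n) (hus n) (hup n)
  have hbound : ∀ t ∈ Set.Icc a b, |t| ≤ max |a| |b| := fun t ht => abs_le_max_abs_abs ht.1 ht.2
  obtain ⟨M, hM⟩ := isCompact_Icc.exists_bound_of_continuousOn (hΦ.continuousOn.mono hJI)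
  obtain ⟨K, hK⟩ := abs_deriv_deriv_le hI ⟨c, hcI⟩ hΦ isCompact_Icc hJI
  have hK' : ∀ n x, |deriv (deriv Φ) (u n x)| ≤ K := fun n x => hK _ ⟨huab n x, hin n x⟩
  have hK0 : 0 ≤ K := (abs_nonneg _).trans (hK' 0 0)
  have hprobH : IsProbabilityMeasure (gibbs H) := isProbabilityMeasure_gibbs h1
  have l1 : Tendsto (fun n => ∫ x, Φ (u n x) ∂gibbs (V n)) atTop (𝓝 (∫ x, Φ (f x) ∂gibbs H)) := by
    refine hVlim _ _ M (fun n => ?_) (fun n x => hM _ (huab n x)) fun x => ?_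
    · exact (hΦ.continuousOn.mono hJI).comp_continuous (hu n).continuous (huab n)
    · exact ((hΦ.continuousOn.mono hJI) (f x) (hfab x)).tendsto.comp
        (tendsto_nhdsWithin_iff.2 ⟨hulim x, Eventually.of_forall fun n => huab n x⟩)
  have l2 : Tendsto (fun n => ∫ x, u n x ∂gibbs (V n)) atTop (𝓝 (∫ x, f x ∂gibbs H)) :=
    hVlim _ _ _ (fun n => (hu n).continuous) (fun n x => hbound _ (huab n x)) hulim
  have hmem : ∀ (μ : Measure (EuclideanSpace ℝ (Fin d))) [IsProbabilityMeasure μ]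
      (g : EuclideanSpace ℝ (Fin d) → ℝ), Continuous g → (∀ x, g x ∈ Set.Icc a b) →
      ∫ x, g x ∂μ ∈ I := fun μ _ g hg hgab =>
    hI.integral_mem hIc (Eventually.of_forall fun x => hJI (hgab x))
      (MeasureTheory.Integrable.of_bound hg.aestronglyMeasurable (max |a| |b|)
        (Eventually.of_forall fun x => hbound _ (hgab x)))
  have l3 : Tendsto (fun n => Φ (∫ x, u n x ∂gibbs (V n))) atTop (𝓝 (Φ (∫ x, f x ∂gibbs H))) := by
    refine (hΦ.continuousOn _ (hmem _ f hf.continuous hfab)).tendsto.comp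
      (tendsto_nhdsWithin_iff.2 ⟨l2, Eventually.of_forall fun n => ?_⟩)
    have := isProbabilityMeasure_gibbs (hV1 n)
    exact hmem _ _ (hu n).continuous (huab n)
  have l4 : Tendsto (fun n => ∫ x, deriv (deriv Φ) (u n x) * ‖fderiv ℝ (u n) x‖ ^ 2 ∂gibbs (V n))
      atTop (𝓝 (∫ x, deriv (deriv Φ) (f x) * ‖fderiv ℝ f x‖ ^ 2 ∂gibbs H)) := by
    refine hVlim _ _ (K * B ^ 2) (fun n => ?_) (fun n x => ?_) fun x => ?_
    · exact (hD.comp_continuous (hu n).continuous (hin n)).mul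
        ((fderiv_contDiff (hu n)).continuous.norm.pow 2)
    · rw [abs_mul, abs_of_nonneg (sq_nonneg ‖fderiv ℝ (u n) x‖)]
      gcongr
      · exact hK' n x
      · exact huB n x
    · by_cases hx : f x ∈ interior I
      · exact ((hD.continuousAt (isOpen_interior.mem_nhds hx)).tendsto.comp (hulim x)).mul
          ((hudlim x).norm.pow 2)
      · have hz := fderiv_eq_zero_of_notMem_interior hI hfI hx
        refine tendsto_const_nhds.congr' ?_
        filter_upwards [hud0 x hz] with n hn
        rw [hn, hz]
        simp
  exact le_of_tendsto_of_tendsto' (l1.sub l3) (l4.const_mul _) hineq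

end PhiSobolev

/-- **Φ-Sobolev inequality for uniformly strictly log-concave measures.** If
`dμ = exp(−H) dx` on `ℝ^d` with `Hess H ≥ ρ > 0`, then under `(H1)` every smooth bounded
function `f : ℝ^d → I` with bounded gradient satisfies
`Ent_μ^Φ(f) ≤ (1/(2ρ)) ∫ Φ''(f) ‖∇f‖² dμ`. -/
theorem phiSobolev_logConcave
    {d : ℕ} (ρ : ℝ) (hρ : 0 < ρ)
    (H : EuclideanSpace ℝ (Fin d) → ℝ) (hH : ContDiff ℝ (⊤ : ℕ∞) H)
    (hHess : ∀ x y : EuclideanSpace ℝ (Fin d),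
      ρ * ‖y‖ ^ 2 ≤ iteratedFDeriv ℝ 2 H x ![y, y])
    (μ : Measure (EuclideanSpace ℝ (Fin d))) [IsProbabilityMeasure μ]
    (hμ : μ = volume.withDensity fun x => ENNReal.ofReal (Real.exp (-H x)))
    (I : Set ℝ) (hI : Convex ℝ I) (hIc : IsClosed I)
    (Φ : ℝ → ℝ) (hΦ : ContDiffOn ℝ 2 Φ I) (hΦconv : ConvexOn ℝ I Φ)
    (hH1nonneg : ∀ u ∈ I, ∀ v : ℝ, 0 ≤ deriv (deriv Φ) u * v ^ 2)
    (hH1conv : ConvexOn ℝ (I ×ˢ (Set.univ : Set ℝ))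
      (fun p : ℝ × ℝ => deriv (deriv Φ) p.1 * p.2 ^ 2))
    (f : EuclideanSpace ℝ (Fin d) → ℝ) (hf : ContDiff ℝ (⊤ : ℕ∞) f) (hfI : ∀ x, f x ∈ I)
    (hfbdd : ∃ C : ℝ, ∀ x, |f x| ≤ C)
    (hgradbdd : ∃ C : ℝ, ∀ x, ‖gradient f x‖ ≤ C) :
    (∫ x, Φ (f x) ∂μ) - Φ (∫ x, f x ∂μ)
      ≤ (1 / (2 * ρ)) * ∫ x, deriv (deriv Φ) (f x) * ‖gradient f x‖ ^ 2 ∂μ := by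
  have hgrad : ∀ x, ‖gradient f x‖ = ‖fderiv ℝ f x‖ := fun x =>
    (InnerProductSpace.toDual ℝ (EuclideanSpace ℝ (Fin d))).symm.norm_map _
  simp only [hgrad] at hgradbdd ⊢
  obtain ⟨C, hC⟩ := hfbdd
  obtain ⟨G, hG⟩ := hgradbdd
  by_cases hconst : ∀ x, f x = f 0
  · have hf' : f = fun _ => f 0 := funext hconst
    rw [hf']
    simp
  push Not at hconst
  obtain ⟨z, hz⟩ := hconst
  have hd : 0 < d := by
    rcases Nat.eq_zero_or_pos d with rfl | h
    · exact absurd (congrArg f (Subsingleton.elim z 0)) hz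
    · exact h
  have hne : (interior I).Nonempty := by
    rcases lt_or_gt_of_ne hz with h | h
    · refine ⟨_, interior_mono (hI.ordConnected.out (hfI z) (hfI 0))
        (?_ : (f z + f 0) / 2 ∈ _)⟩
      rw [interior_Icc]
      constructor <;> linarith
    · refine ⟨_, interior_mono (hI.ordConnected.out (hfI 0) (hfI z))
        (?_ : (f z + f 0) / 2 ∈ _)⟩
      rw [interior_Icc]
      constructor <;> linarith
  have hμ' : μ = PhiSobolev.gibbs H := hμ
  have h1 : ∫ x, Real.exp (-H x) = 1 := by
    have := PhiSobolev.integral_gibbs hH.continuous (fun _ => 1)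
    rw [← hμ'] at this
    simpa using this.symm
  rw [hμ']
  refine PhiSobolev.entropy_le_of_nonempty_interior hd hρ hH (fun x y => ?_) h1 hI hIc hne hΦ
    (fun t ht => by simpa using hH1nonneg t ht 1) hH1conv hf hfI hC hG
  simpa [iteratedFDeriv_two_apply] using hHess x y
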